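/- arXiv:math/0001116 — 2 statements merged into one kernel-verified Lean document; each statement's English description precedes it below -/
import Mathlib

section
/- Assume in addition that the hatted frame is k₀-nondegenerate and adapted at 0: there exist integers 0 = r₀ ≤ r₁ ≤ ⋯ ≤ r_{k₀} = n such that (a) ĥ_{Ā₁…Ā_j a}(0) = 0 whenever 1 ≤ j ≤ k₀ and a > r_j, and (b) for each 1 ≤ k ≤ k₀: if v ∈ ℂ^n satisfies v_a = 0 for all a ≤ r_{k−1} and Σ_{a=r_{k−1}+1}^{n} v_a·ĥ_{Ā₁…Ā_k a}(0) = 0 for all A₁, …, A_k ∈ {1,…,n}, then v_a = 0 for all a ≤ r_k. Then for all D, E ∈ {1,…,n} there exist functions r^D_E and s^D — each a rational function of the variables corresponding to conj(L^J γ^C_A) (C, A ∈ {1,…,n}, J ∈ {1,…,n}^t, 0 ≤ t ≤ k₀−1) and polynomial in the variables corresponding to conj(L^I ξ) (I ∈ {1,…,n}^t, 0 ≤ t ≤ k₀), whose coefficients are smooth functions of (x, x̂) ∈ Ω × Ω̂ depending only on the two frames and not on f — such that for every smooth diffeomorphism f : Ω → Ω̂ with f(0) = 0 carrying data (γ^A_B,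 η^A, ξ) as in the setup, the identities γ^D_E = r^D_E(conj(L^J γ^C_A), conj(L^I ξ); f) and η^D = s^D(conj(L^J γ^C_A), conj(L^I ξ); f) hold on a neighborhood of 0 (the denominators being nonvanishing there). Here L^J := L_{J₁} ∘ ⋯ ∘ L_{J_t}, conj denotes complex conjugation, and g(…; f)(x) means the expression evaluated at the indicated function values at x with coefficients evaluated at (x, f(x)). -/
open scoped Topology

noncomputable section

/-- A complex vector field on (an open subset of) `ℝ^m`, given by its components:
it acts on functions by `(Xu)(x) = Du(x)·X(x)`. -/
abbrev VF (m : ℕ) := (Fin m → ℝ) → Fin m → ℂ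

/-- The action `(Xu)(x) = Du(x)·X(x)` of a complex vector field on a function. -/
noncomputable def vapp {m : ℕ} (X : VF m) (u : (Fin m → ℝ) → ℂ) (x : Fin m → ℝ) : ℂ :=
  ∑ i, X x i * fderiv ℝ u x (Pi.single i 1)

/-- The Lie bracket `[X,Y](x) = DY(x)·X(x) − DX(x)·Y(x)` of complex vector fields. -/
noncomputable def vbrk {m : ℕ} (X Y : VF m) : VF m :=
  fun x j => vapp X (fun y => Y y j) x - vapp Y (fun y => X y j) x

/-- The componentwise complex conjugate `X̄` of a complex vector field. -/
def vconj {m : ℕ} (X : VF m) : VF m := fun x i => (starRingEnd ℂ) (X x i)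

/-- A normalized frame (Lemma 1.33): `T, L_A, L_Ā` is a smooth pointwise basis of `ℂ^{2n+1}`
on `Ω` with `T` real, `[L_A, L_B] = 0`, `[L_Ā, L_B] = −h_{ĀB}·T`, `[L_Ā, T] = −h_Ā·T`, and
each `[L_A, T]` a smooth multiple of `T`.  The fields `lv` and `hb` are the Levi functions
`h_{ĀB}` and `h_Ā`. -/
structure NFrame (n : ℕ) (Ω : Set (Fin (2 * n + 1) → ℝ)) (T : VF (2 * n + 1))
    (L : Fin n → VF (2 * n + 1))
    (lv : Fin n → Fin n → (Fin (2 * n + 1) → ℝ) → ℂ)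
    (hb : Fin n → (Fin (2 * n + 1) → ℝ) → ℂ) : Prop where
  open_Ω : IsOpen Ω
  mem0 : (0 : Fin (2 * n + 1) → ℝ) ∈ Ω
  smoothT : ContDiffOn ℝ (⊤ : ℕ∞) T Ω
  smoothL : ∀ A, ContDiffOn ℝ (⊤ : ℕ∞) (L A) Ω
  smooth_lv : ∀ A B, ContDiffOn ℝ (⊤ : ℕ∞) (lv A B) Ω
  smooth_hb : ∀ A, ContDiffOn ℝ (⊤ : ℕ∞) (hb A) Ω
  Treal : ∀ x i, (starRingEnd ℂ) (T x i) = T x i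
  indep : ∀ x ∈ Ω, LinearIndependent ℂ
    (Sum.elim (fun _ : Fin 1 => T x) (Sum.elim (fun A => L A x) (fun A => vconj (L A) x)))
  spans : ∀ x ∈ Ω, Submodule.span ℂ
    (Set.range (Sum.elim (fun _ : Fin 1 => T x)
      (Sum.elim (fun A => L A x) (fun A => vconj (L A) x)))) = ⊤
  commLL : ∀ A B, ∀ x ∈ Ω, vbrk (L A) (L B) x = 0
  commLbL : ∀ A B, ∀ x ∈ Ω, vbrk (vconj (L A)) (L B) x = fun i => -(lv A B x) * T x i
  commLbT : ∀ A, ∀ x ∈ Ω, vbrk (vconj (L A)) T x = fun i => -(hb A x) * T x i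
  commLT : ∀ A, ∃ c : (Fin (2 * n + 1) → ℝ) → ℂ, ContDiffOn ℝ (⊤ : ℕ∞) c Ω ∧
    ∀ x ∈ Ω, vbrk (L A) T x = fun i => c x * T x i

/-- Auxiliary: the iterated Levi function `h_{Ā₁…Ā_k}` (`T`-component), with the index list
given in *reverse* order `[A_k,…,A₁]`, defined by the recursion
`h_{Ās C̄} = L_C̄ h_{Ās} + h_{Ās}·h_C̄`. -/
noncomputable def hTrev {n : ℕ} (L : Fin n → VF (2 * n + 1))
    (hb : Fin n → (Fin (2 * n + 1) → ℝ) → ℂ) :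
    List (Fin n) → (Fin (2 * n + 1) → ℝ) → ℂ
  | [] => fun _ => 1
  | [C] => hb C
  | C :: rest => fun x =>
      vapp (vconj (L C)) (hTrev L hb rest) x + hTrev L hb rest x * hb C x

/-- Auxiliary: the iterated Levi function `h_{Ā₁…Ā_k D}`, with the index list given in
*reverse* order `[A_k,…,A₁]`, defined by the recursion
`h_{Ās C̄ D} = L_C̄ h_{Ās D} + h_{Ās}·h_{C̄D}`. -/
noncomputable def hDrev {n : ℕ} (L : Fin n → VF (2 * n + 1))
    (lv : Fin n → Fin n → (Fin (2 * n + 1) → ℝ) → ℂ)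
    (hb : Fin n → (Fin (2 * n + 1) → ℝ) → ℂ) :
    List (Fin n) → Fin n → (Fin (2 * n + 1) → ℝ) → ℂ
  | [], _ => fun _ => 0
  | [C], D => lv C D
  | C :: rest, D => fun x =>
      vapp (vconj (L C)) (hDrev L lv hb rest D) x + hTrev L hb rest x * lv C D x

/-- The iterated Levi function `h_{Ā₁…Ā_k D}`, for `As = [A₁,…,A_k]`. -/
noncomputable def hIt {n : ℕ} (L : Fin n → VF (2 * n + 1))
    (lv : Fin n → Fin n → (Fin (2 * n + 1) → ℝ) → ℂ)
    (hb : Fin n → (Fin (2 * n + 1) → ℝ) → ℂ)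
    (As : List (Fin n)) (D : Fin n) : (Fin (2 * n + 1) → ℝ) → ℂ :=
  hDrev L lv hb As.reverse D

/-- The iterated Levi function `h_{Ā₁…Ā_k}`, for `As = [A₁,…,A_k]`. -/
noncomputable def hTIt {n : ℕ} (L : Fin n → VF (2 * n + 1))
    (hb : Fin n → (Fin (2 * n + 1) → ℝ) → ℂ)
    (As : List (Fin n)) : (Fin (2 * n + 1) → ℝ) → ℂ :=
  hTrev L hb As.reverse

/-- The data of a CR diffeomorphism `f : Ω → Ω̂` expressed in two normalized frames
(Context 10/11/12): `Df·L_B = Σ γ^A_B L̂_A`, `Df·L_B̄ = Σ conj(γ^A_B) L̂_Ā`,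
`Df·T = ξ T̂ + Σ η^A L̂_A + Σ conj(η^A) L̂_Ā`, with `(γ^A_B)` pointwise invertible,
`ξ` real valued, and `f` a smooth diffeomorphism with `f(0) = 0`. -/
structure CRTrans (n : ℕ) (Ω Ωh : Set (Fin (2 * n + 1) → ℝ))
    (T : VF (2 * n + 1)) (L : Fin n → VF (2 * n + 1))
    (Th : VF (2 * n + 1)) (Lh : Fin n → VF (2 * n + 1))
    (f : (Fin (2 * n + 1) → ℝ) → (Fin (2 * n + 1) → ℝ))
    (γ : Fin n → Fin n → (Fin (2 * n + 1) → ℝ) → ℂ)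
    (η : Fin n → (Fin (2 * n + 1) → ℝ) → ℂ)
    (ξ : (Fin (2 * n + 1) → ℝ) → ℝ) : Prop where
  smooth_f : ContDiffOn ℝ (⊤ : ℕ∞) f Ω
  maps : Set.MapsTo f Ω Ωh
  f0 : f 0 = 0
  diffeo : ∃ g, ContDiffOn ℝ (⊤ : ℕ∞) g Ωh ∧ Set.MapsTo g Ωh Ω ∧
    (∀ x ∈ Ω, g (f x) = x) ∧ ∀ y ∈ Ωh, f (g y) = y
  smooth_γ : ∀ A B, ContDiffOn ℝ (⊤ : ℕ∞) (γ A B) Ω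
  smooth_η : ∀ A, ContDiffOn ℝ (⊤ : ℕ∞) (η A) Ω
  smooth_ξ : ContDiffOn ℝ (⊤ : ℕ∞) ξ Ω
  γ_inv : ∀ x ∈ Ω, IsUnit (Matrix.of fun A B => γ A B x)
  pushL : ∀ B, ∀ x ∈ Ω, ∀ j, vapp (L B) (fun y => ((f y j : ℝ) : ℂ)) x =
    ∑ A, γ A B x * Lh A (f x) j
  pushLb : ∀ B, ∀ x ∈ Ω, ∀ j, vapp (vconj (L B)) (fun y => ((f y j : ℝ) : ℂ)) x =
    ∑ A, (starRingEnd ℂ) (γ A B x) * vconj (Lh A) (f x) j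
  pushT : ∀ x ∈ Ω, ∀ j, vapp T (fun y => ((f y j : ℝ) : ℂ)) x =
    (ξ x : ℂ) * Th (f x) j + (∑ A, η A x * Lh A (f x) j)
      + ∑ A, (starRingEnd ℂ) (η A x) * vconj (Lh A) (f x) j

/-- The composition `L^J = L_{J₁} ∘ ⋯ ∘ L_{J_t}` applied to a function, for `J = [J₁,…,J_t]`. -/
noncomputable def appOp {n : ℕ} (L : Fin n → VF (2 * n + 1)) (J : List (Fin n))
    (u : (Fin (2 * n + 1) → ℝ) → ℂ) : (Fin (2 * n + 1) → ℝ) → ℂ :=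
  J.foldr (fun j v => vapp (L j) v) u

/-- Index type of the variables corresponding to `conj(L^J γ^C_A)`, `|J| ≤ k₀−1`. -/
abbrev PolyVarγ (n k₀ : ℕ) := Fin n × Fin n × {J : List (Fin n) // J.length ≤ k₀ - 1}

/-- Index type of the variables corresponding to `conj(L^I ξ)`, `|I| ≤ k₀`. -/
abbrev PolyVarξ (n k₀ : ℕ) := {I : List (Fin n) // I.length ≤ k₀}

/-- All variables. -/
abbrev PolyVar (n k₀ : ℕ) := PolyVarγ n k₀ ⊕ PolyVarξ n k₀

/-- The coefficient ring: functions of `(x, x̂) ∈ ℝ^{2n+1} × ℝ^{2n+1}`. -/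
abbrev CoefR (n : ℕ) := ((Fin (2 * n + 1) → ℝ) × (Fin (2 * n + 1) → ℝ)) → ℂ

/-- Evaluation of a polynomial in the variables `conj(L^J γ^C_A)` at `x`, coefficients being
evaluated at `(x, f(x))`. -/
noncomputable def evalγ {n k₀ : ℕ} (L : Fin n → VF (2 * n + 1))
    (γ : Fin n → Fin n → (Fin (2 * n + 1) → ℝ) → ℂ)
    (f : (Fin (2 * n + 1) → ℝ) → (Fin (2 * n + 1) → ℝ))
    (P : MvPolynomial (PolyVarγ n k₀) (CoefR n)) (x : Fin (2 * n + 1) → ℝ) : ℂ :=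
  MvPolynomial.eval₂ (Pi.evalRingHom (fun _ => ℂ) (x, f x))
    (fun v => (starRingEnd ℂ) (appOp L v.2.2.1 (γ v.1 v.2.1) x)) P

/-- Evaluation of a polynomial in the variables `conj(L^J γ^C_A)` and `conj(L^I ξ)`. -/
noncomputable def evalγξ {n k₀ : ℕ} (L : Fin n → VF (2 * n + 1))
    (γ : Fin n → Fin n → (Fin (2 * n + 1) → ℝ) → ℂ)
    (ξ : (Fin (2 * n + 1) → ℝ) → ℝ)
    (f : (Fin (2 * n + 1) → ℝ) → (Fin (2 * n + 1) → ℝ))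
    (P : MvPolynomial (PolyVar n k₀) (CoefR n)) (x : Fin (2 * n + 1) → ℝ) : ℂ :=
  MvPolynomial.eval₂ (Pi.evalRingHom (fun _ => ℂ) (x, f x))
    (Sum.elim (fun v => (starRingEnd ℂ) (appOp L v.2.2.1 (γ v.1 v.2.1) x))
      (fun I => (starRingEnd ℂ) (appOp L I.1 (fun y => ((ξ y : ℝ) : ℂ)) x))) P


section Calc

variable {m : ℕ}

lemma vapp_congr_on {X : VF m} {u v : (Fin m → ℝ) → ℂ} {Ω : Set (Fin m → ℝ)} (hΩ : IsOpen Ω)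
    (h : ∀ x ∈ Ω, u x = v x) {x : Fin m → ℝ} (hx : x ∈ Ω) : vapp X u x = vapp X v x := by
  have : u =ᶠ[𝓝 x] v := by
    filter_upwards [hΩ.mem_nhds hx] with y hy using h y hy
  simp only [vapp, this.fderiv_eq]

lemma vapp_const (X : VF m) (c : ℂ) (x : Fin m → ℝ) : vapp X (fun _ => c) x = 0 := by
  simp [vapp]

lemma vapp_add (X : VF m) {u v : (Fin m → ℝ) → ℂ} {x : Fin m → ℝ}
    (hu : DifferentiableAt ℝ u x) (hv : DifferentiableAt ℝ v x) :
    vapp X (fun y => u y + v y) x = vapp X u x + vapp X v x := by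
  simp only [vapp, fderiv_fun_add hu hv, ← Finset.sum_add_distrib]
  simp [mul_add]

lemma vapp_sum {ι : Type*} [Fintype ι] (X : VF m) {u : ι → (Fin m → ℝ) → ℂ} {x : Fin m → ℝ}
    (hu : ∀ i, DifferentiableAt ℝ (u i) x) :
    vapp X (fun y => ∑ i, u i y) x = ∑ i, vapp X (u i) x := by
  simp only [vapp]
  rw [fderiv_fun_sum (fun i _ => hu i), Finset.sum_comm]
  simp [Finset.mul_sum]

lemma vapp_mul (X : VF m) {u v : (Fin m → ℝ) → ℂ} {x : Fin m → ℝ}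
    (hu : DifferentiableAt ℝ u x) (hv : DifferentiableAt ℝ v x) :
    vapp X (fun y => u y * v y) x = vapp X u x * v x + u x * vapp X v x := by
  simp only [vapp, fderiv_fun_mul hu hv, Finset.sum_mul, Finset.mul_sum,
    ← Finset.sum_add_distrib]
  refine Finset.sum_congr rfl fun i _ => ?_
  simp
  ring

lemma vapp_inv (X : VF m) {u : (Fin m → ℝ) → ℂ} {x : Fin m → ℝ}
    (hu : DifferentiableAt ℝ u x) (h0 : u x ≠ 0) :
    vapp X (fun y => (u y)⁻¹) x = - ((u x)⁻¹ * (u x)⁻¹ * vapp X u x) := by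
  have hc : ContinuousAt u x := hu.continuousAt
  have hi : DifferentiableAt ℝ (fun y => (u y)⁻¹) x := hu.inv h0
  have h1 := vapp_mul X hu hi
  have h2 : vapp X (fun y => u y * (u y)⁻¹) x = 0 := by
    have : (fun y => u y * (u y)⁻¹) =ᶠ[𝓝 x] fun _ => (1 : ℂ) := by
      filter_upwards [hc.eventually_ne h0] with y hy using mul_inv_cancel₀ hy
    simp [vapp, this.fderiv_eq]
  rw [h2] at h1
  field_simp at h1 ⊢
  linear_combination -h1

lemma vapp_conj (X : VF m) (u : (Fin m → ℝ) → ℂ) (x : Fin m → ℝ) :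
    vapp (vconj X) (fun y => (starRingEnd ℂ) (u y)) x = (starRingEnd ℂ) (vapp X u x) := by
  have : fderiv ℝ (fun y => (starRingEnd ℂ) (u y)) x
      = (Complex.conjCLE : ℂ →L[ℝ] ℂ).comp (fderiv ℝ u x) :=
    Complex.conjCLE.comp_fderiv (f := u) (x := x)
  simp [vapp, this, vconj]

lemma vapp_smul_left (X Y : VF m) (u : (Fin m → ℝ) → ℂ) (x : Fin m → ℝ) (c : ℂ)
    (h : X x = fun i => c * Y x i) : vapp X u x = c * vapp Y u x := by
  simp [vapp, h, Finset.mul_sum, mul_assoc]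

lemma sm_comp_apply {ι : Type*} [Fintype ι] {X : (Fin m → ℝ) → ι → ℂ} {Ω : Set (Fin m → ℝ)}
    (hX : ContDiffOn ℝ (⊤ : ℕ∞) X Ω) (i : ι) : ContDiffOn ℝ (⊤ : ℕ∞) (fun x => X x i) Ω :=
  contDiffOn_pi.1 hX i

lemma sm_fderiv {F : Type*} [NormedAddCommGroup F] [NormedSpace ℝ F]
    {u : (Fin m → ℝ) → F} {Ω : Set (Fin m → ℝ)} (hΩ : IsOpen Ω)
    (hu : ContDiffOn ℝ (⊤ : ℕ∞) u Ω) : ContDiffOn ℝ (⊤ : ℕ∞) (fderiv ℝ u) Ω :=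
  hu.fderiv_of_isOpen hΩ (by simp)

lemma sm_vapp {X : VF m} {u : (Fin m → ℝ) → ℂ} {Ω : Set (Fin m → ℝ)} (hΩ : IsOpen Ω)
    (hX : ContDiffOn ℝ (⊤ : ℕ∞) X Ω) (hu : ContDiffOn ℝ (⊤ : ℕ∞) u Ω) :
    ContDiffOn ℝ (⊤ : ℕ∞) (vapp X u) Ω := by
  unfold vapp
  refine ContDiffOn.sum fun i _ => ?_
  exact (sm_comp_apply hX i).mul ((sm_fderiv hΩ hu).clm_apply contDiffOn_const)

lemma sm_conj {u : (Fin m → ℝ) → ℂ} {Ω : Set (Fin m → ℝ)}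
    (hu : ContDiffOn ℝ (⊤ : ℕ∞) u Ω) :
    ContDiffOn ℝ (⊤ : ℕ∞) (fun x => (starRingEnd ℂ) (u x)) Ω :=
  Complex.conjCLE.contDiff.comp_contDiffOn hu

lemma sm_vconj {X : VF m} {Ω : Set (Fin m → ℝ)}
    (hX : ContDiffOn ℝ (⊤ : ℕ∞) X Ω) : ContDiffOn ℝ (⊤ : ℕ∞) (vconj X) Ω :=
  contDiffOn_pi.2 fun i => sm_conj (sm_comp_apply hX i)

lemma sm_diff {F : Type*} [NormedAddCommGroup F] [NormedSpace ℝ F]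
    {u : (Fin m → ℝ) → F} {Ω : Set (Fin m → ℝ)} (hΩ : IsOpen Ω)
    (hu : ContDiffOn ℝ (⊤ : ℕ∞) u Ω) {x : Fin m → ℝ} (hx : x ∈ Ω) : DifferentiableAt ℝ u x :=
  (hu.contDiffAt (hΩ.mem_nhds hx)).differentiableAt (by simp)

lemma sm_ofReal {u : (Fin m → ℝ) → ℝ} {Ω : Set (Fin m → ℝ)}
    (hu : ContDiffOn ℝ (⊤ : ℕ∞) u Ω) : ContDiffOn ℝ (⊤ : ℕ∞) (fun x => ((u x : ℝ) : ℂ)) Ω :=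
  Complex.ofRealCLM.contDiff.comp_contDiffOn hu

/-- commutator formula -/
lemma vapp_vbrk {X Y : VF m} {u : (Fin m → ℝ) → ℂ} {Ω : Set (Fin m → ℝ)} (hΩ : IsOpen Ω)
    (hX : ContDiffOn ℝ (⊤ : ℕ∞) X Ω) (hY : ContDiffOn ℝ (⊤ : ℕ∞) Y Ω)
    (hu : ContDiffOn ℝ (⊤ : ℕ∞) u Ω) {x : Fin m → ℝ} (hx : x ∈ Ω) :
    vapp X (vapp Y u) x - vapp Y (vapp X u) x = vapp (vbrk X Y) u x := by
  have key : ∀ (X Y : VF m), ContDiffOn ℝ (⊤ : ℕ∞) X Ω → ContDiffOn ℝ (⊤ : ℕ∞) Y Ω →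
      vapp X (vapp Y u) x = (∑ j, vapp X (fun y => Y y j) x * fderiv ℝ u x (Pi.single j 1)) +
        ∑ j, ∑ i, X x i * Y x j * fderiv ℝ (fderiv ℝ u) x (Pi.single i 1) (Pi.single j 1) := by
    intro X Y hX hY
    have hd : ∀ j : Fin m, DifferentiableAt ℝ (fun y => fderiv ℝ u y (Pi.single j 1)) x :=
      fun j => sm_diff hΩ ((sm_fderiv hΩ hu).clm_apply contDiffOn_const) hx
    have hYd : ∀ j : Fin m, DifferentiableAt ℝ (fun y => Y y j) x :=
      fun j => sm_diff hΩ (sm_comp_apply hY j) hx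
    have : vapp X (vapp Y u) x =
      vapp X (fun y => ∑ j, Y y j * fderiv ℝ u y (Pi.single j 1)) x := rfl
    rw [this, vapp_sum X (fun j => (hYd j).fun_mul (hd j)), ← Finset.sum_add_distrib]
    refine Finset.sum_congr rfl fun j _ => ?_
    rw [vapp_mul X (hYd j) (hd j)]
    congr 1
    have e : fderiv ℝ (fun y => fderiv ℝ u y (Pi.single j 1)) x =
        (fderiv ℝ (fderiv ℝ u) x).flip (Pi.single j 1) := by
      have h1 : DifferentiableAt ℝ (fderiv ℝ u) x := sm_diff hΩ (sm_fderiv hΩ hu) hx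
      ext i
      rw [fderiv_clm_apply h1 (differentiableAt_const _)]
      simp
    simp only [vapp, e, Finset.mul_sum]
    refine Finset.sum_congr rfl fun i _ => ?_
    simp
    ring
  have hsym : IsSymmSndFDerivAt ℝ u x :=
    (hu.contDiffAt (hΩ.mem_nhds hx)).isSymmSndFDerivAt
      (by simp only [minSmoothness_of_isRCLikeNormedField]; exact WithTop.coe_le_coe.2 (le_top : (2 : ℕ∞) ≤ ⊤))
  rw [key X Y hX hY, key Y X hY hX]
  have h2 : ∑ j, ∑ i, Y x i * X x j * fderiv ℝ (fderiv ℝ u) x (Pi.single i 1) (Pi.single j 1)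
      = ∑ j, ∑ i, X x i * Y x j * fderiv ℝ (fderiv ℝ u) x (Pi.single i 1) (Pi.single j 1) := by
    rw [Finset.sum_comm]
    refine Finset.sum_congr rfl fun j _ => Finset.sum_congr rfl fun i _ => ?_
    rw [hsym.eq]
    ring
  rw [h2]
  have h3 : vapp (vbrk X Y) u x = (∑ j, vapp X (fun y => Y y j) x * fderiv ℝ u x (Pi.single j 1))
     - ∑ j, vapp Y (fun y => X y j) x * fderiv ℝ u x (Pi.single j 1) := by
    rw [← Finset.sum_sub_distrib]
    simp [vapp, vbrk, sub_mul]
  rw [h3]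
  ring

lemma vapp_comp {X : VF m} {u : (Fin m → ℝ) → ℂ} {f : (Fin m → ℝ) → (Fin m → ℝ)}
    {x : Fin m → ℝ} (hf : DifferentiableAt ℝ f x) (hu : DifferentiableAt ℝ u (f x)) :
    vapp X (fun y => u (f y)) x =
      ∑ j, vapp X (fun y => ((f y j : ℝ) : ℂ)) x * fderiv ℝ u (f x) (Pi.single j 1) := by
  have e : fderiv ℝ (fun y => u (f y)) x = (fderiv ℝ u (f x)).comp (fderiv ℝ f x) :=
    fderiv_comp x hu hf
  have e2 : ∀ j i, fderiv ℝ (fun y => ((f y j : ℝ) : ℂ)) x i = ((fderiv ℝ f x i j : ℝ) : ℂ) := by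
    intro j i
    have hj : HasFDerivAt (fun y => f y j)
        ((ContinuousLinearMap.proj (R := ℝ) (φ := fun _ : Fin m => ℝ) j).comp (fderiv ℝ f x)) x :=
      (hasFDerivAt_pi'.1 hf.hasFDerivAt) j
    have := (Complex.ofRealCLM.hasFDerivAt (x := f x j)).comp x hj
    have h3 : HasFDerivAt (fun y => ((f y j : ℝ) : ℂ)) _ x := this
    rw [h3.fderiv]
    simp
  simp only [vapp, e, e2, Finset.sum_mul]
  rw [Finset.sum_comm]
  refine Finset.sum_congr rfl fun i _ => ?_
  have e3 : fderiv ℝ f x (Pi.single i 1) =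
      ∑ j, (fderiv ℝ f x (Pi.single i 1) j) • (Pi.single j (1 : ℝ) : Fin m → ℝ) := by
    ext k
    simp [Finset.sum_apply, Pi.single_apply]
  rw [ContinuousLinearMap.comp_apply]
  conv_lhs => rw [e3]
  rw [map_sum, Finset.mul_sum]
  refine Finset.sum_congr rfl fun j _ => ?_
  rw [map_smul, Complex.real_smul]
  ring

/-- chain rule through a frame -/
lemma vapp_comp_frame {K : Type*} [Fintype K] {X : VF m} {u : (Fin m → ℝ) → ℂ}
    {f : (Fin m → ℝ) → (Fin m → ℝ)} {x : Fin m → ℝ} (hf : DifferentiableAt ℝ f x)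
    (hu : DifferentiableAt ℝ u (f x)) (E : K → VF m) (a : K → ℂ)
    (ha : ∀ j, vapp X (fun y => ((f y j : ℝ) : ℂ)) x = ∑ k, a k * E k (f x) j) :
    vapp X (fun y => u (f y)) x = ∑ k, a k * vapp (E k) u (f x) := by
  rw [vapp_comp hf hu]
  simp only [ha]
  simp only [vapp, Finset.sum_mul, Finset.mul_sum]
  rw [Finset.sum_comm]
  simp [mul_assoc]

lemma push_brk {K : Type*} [Fintype K] {X Y : VF m} {f : (Fin m → ℝ) → (Fin m → ℝ)}
    {Ω Ωh : Set (Fin m → ℝ)} (hΩ : IsOpen Ω) (hΩh : IsOpen Ωh)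
    (hX : ContDiffOn ℝ (⊤ : ℕ∞) X Ω) (hY : ContDiffOn ℝ (⊤ : ℕ∞) Y Ω)
    (hf : ContDiffOn ℝ (⊤ : ℕ∞) f Ω) (hm : Set.MapsTo f Ω Ωh)
    (E : K → VF m) (hE : ∀ k, ContDiffOn ℝ (⊤ : ℕ∞) (E k) Ωh)
    (a b : K → (Fin m → ℝ) → ℂ) (ha : ∀ k, ContDiffOn ℝ (⊤ : ℕ∞) (a k) Ω)
    (hb : ∀ k, ContDiffOn ℝ (⊤ : ℕ∞) (b k) Ω)
    (pa : ∀ x ∈ Ω, ∀ j, vapp X (fun y => ((f y j : ℝ) : ℂ)) x = ∑ k, a k x * E k (f x) j)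
    (pb : ∀ x ∈ Ω, ∀ j, vapp Y (fun y => ((f y j : ℝ) : ℂ)) x = ∑ k, b k x * E k (f x) j)
    {x : Fin m → ℝ} (hx : x ∈ Ω) (j : Fin m) :
    vapp (vbrk X Y) (fun y => ((f y j : ℝ) : ℂ)) x =
      (∑ k, (vapp X (b k) x - vapp Y (a k) x) * E k (f x) j) +
      ∑ k, ∑ l, a k x * b l x * vbrk (E k) (E l) (f x) j := by
  have hfd := sm_diff hΩ hf hx
  have key : ∀ (X Y : VF m) (a b : K → (Fin m → ℝ) → ℂ),
     (∀ k, ContDiffOn ℝ (⊤ : ℕ∞) (b k) Ω) →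
     (∀ x ∈ Ω, ∀ j, vapp X (fun y => ((f y j : ℝ) : ℂ)) x = ∑ k, a k x * E k (f x) j) →
     (∀ x ∈ Ω, ∀ j, vapp Y (fun y => ((f y j : ℝ) : ℂ)) x = ∑ k, b k x * E k (f x) j) →
     vapp X (vapp Y (fun y => ((f y j : ℝ) : ℂ))) x = (∑ l, vapp X (b l) x * E l (f x) j) +
       ∑ l, ∑ k, a k x * b l x * vapp (E k) (fun y => E l y j) (f x) := by
    intro X Y a b hb pa pb
    rw [vapp_congr_on hΩ (fun y hy => pb y hy j) hx]
    have h1 : ∀ l, DifferentiableAt ℝ (fun y => E l y j) (f x) := fun l =>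
      sm_diff hΩh (sm_comp_apply (hE l) j) (hm hx)
    have h2 : ∀ l, DifferentiableAt ℝ (fun y => E l (f y) j) x := fun l =>
      (h1 l).comp x hfd
    have h3 : ∀ l, DifferentiableAt ℝ (b l) x := fun l => sm_diff hΩ (hb l) hx
    rw [vapp_sum X (fun l => (h3 l).fun_mul (h2 l)), ← Finset.sum_add_distrib]
    refine Finset.sum_congr rfl fun l _ => ?_
    rw [vapp_mul X (h3 l) (h2 l), vapp_comp_frame hfd (h1 l) E (fun k => a k x) (pa x hx),
      Finset.mul_sum]
    congr 1
    refine Finset.sum_congr rfl fun k _ => ?_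
    ring
  rw [← vapp_vbrk hΩ hX hY (sm_ofReal (contDiffOn_pi.1 hf j)) hx,
    key X Y a b hb pa pb, key Y X b a ha pb pa]
  simp only [vbrk, mul_sub, sub_mul, Finset.sum_sub_distrib]
  rw [Finset.sum_comm (f := fun l k => a k x * b l x * vapp (E k) (fun y => E l y j) (f x))]
  have : ∑ l, ∑ k, b k x * a l x * vapp (E k) (fun y => E l y j) (f x) =
    ∑ l, ∑ k, a l x * b k x * vapp (E k) (fun y => E l y j) (f x) := by
    simp only [mul_comm]
  rw [this]
  ring

lemma vbrk_conj (X Y : VF m) (x : Fin m → ℝ) :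
    vbrk (vconj X) (vconj Y) x = fun i => (starRingEnd ℂ) (vbrk X Y x i) := by
  ext i
  have := vapp_conj X (fun y => Y y i) x
  have h2 := vapp_conj Y (fun y => X y i) x
  simp only [vbrk, map_sub, ← this, ← h2]
  rfl

end Calc

section Struct

variable {n : ℕ} {Ω Ωh : Set (Fin (2 * n + 1) → ℝ)}
    {T : VF (2 * n + 1)} {L : Fin n → VF (2 * n + 1)}
    {lv : Fin n → Fin n → (Fin (2 * n + 1) → ℝ) → ℂ}
    {hb : Fin n → (Fin (2 * n + 1) → ℝ) → ℂ}
    {Th : VF (2 * n + 1)} {Lh : Fin n → VF (2 * n + 1)}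
    {lvh : Fin n → Fin n → (Fin (2 * n + 1) → ℝ) → ℂ}
    {hbh : Fin n → (Fin (2 * n + 1) → ℝ) → ℂ}

/-- The frame as a single family. -/
def frE (T : VF (2 * n + 1)) (L : Fin n → VF (2 * n + 1)) :
    Fin 1 ⊕ Fin n ⊕ Fin n → VF (2 * n + 1) :=
  Sum.elim (fun _ => T) (Sum.elim L (fun A => vconj (L A)))

lemma frE_smooth (hF : NFrame n Ω T L lv hb) (k : Fin 1 ⊕ Fin n ⊕ Fin n) :
    ContDiffOn ℝ (⊤ : ℕ∞) (frE T L k) Ω := by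
  rcases k with k | k | k
  · exact hF.smoothT
  · exact hF.smoothL k
  · exact sm_vconj (hF.smoothL k)

lemma frE_indep (hF : NFrame n Ω T L lv hb) {y : Fin (2 * n + 1) → ℝ} (hy : y ∈ Ω)
    (t : ℂ) (a b : Fin n → ℂ)
    (h : ∀ j, t * T y j + (∑ A, a A * L A y j) + ∑ A, b A * vconj (L A) y j = 0) :
    t = 0 ∧ (∀ A, a A = 0) ∧ ∀ A, b A = 0 := by
  have h1 := Fintype.linearIndependent_iff.1 (hF.indep y hy)
    (Sum.elim (fun _ => t) (Sum.elim a b)) (by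
      ext j
      have := h j
      simpa [Fintype.sum_sum_type, Finset.sum_apply, add_assoc] using this)
  exact ⟨h1 (Sum.inl 0), fun A => h1 (Sum.inr (Sum.inl A)), fun A => h1 (Sum.inr (Sum.inr A))⟩

variable {f : (Fin (2 * n + 1) → ℝ) → (Fin (2 * n + 1) → ℝ)}
    {γ : Fin n → Fin n → (Fin (2 * n + 1) → ℝ) → ℂ}
    {η : Fin n → (Fin (2 * n + 1) → ℝ) → ℂ}
    {ξ : (Fin (2 * n + 1) → ℝ) → ℝ}

lemma struct1 (hF : NFrame n Ω T L lv hb) (hFh : NFrame n Ωh Th Lh lvh hbh)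
    (h : CRTrans n Ω Ωh T L Th Lh f γ η ξ) (A B : Fin n) {x : Fin (2 * n + 1) → ℝ}
    (hx : x ∈ Ω) :
    (∑ D, ∑ C, (starRingEnd ℂ) (γ D A x) * γ C B x * lvh D C (f x) = lv A B x * ξ x) ∧
    ∀ C, vapp (vconj (L A)) (γ C B) x = - (lv A B x * η C x) := by
  have key := push_brk (X := vconj (L A)) (Y := L B) hF.open_Ω hFh.open_Ω
    (sm_vconj (hF.smoothL A)) (hF.smoothL B) h.smooth_f h.maps (frE Th Lh) (frE_smooth hFh)
    (Sum.elim (fun _ _ => 0) (Sum.elim (fun _ _ => 0) (fun D x => (starRingEnd ℂ) (γ D A x))))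
    (Sum.elim (fun _ _ => 0) (Sum.elim (fun C => γ C B) (fun _ _ => 0)))
    (by
      rintro (k | k | k)
      · exact contDiffOn_const
      · exact contDiffOn_const
      · exact sm_conj (h.smooth_γ k A))
    (by
      rintro (k | k | k)
      · exact contDiffOn_const
      · exact h.smooth_γ k B
      · exact contDiffOn_const)
    (by
      intro x hx j
      simp [h.pushLb A x hx j, Fintype.sum_sum_type, frE])
    (by
      intro x hx j
      simp [h.pushL B x hx j, Fintype.sum_sum_type, frE]) hx
  have hT : ∀ j, vapp (vbrk (vconj (L A)) (L B)) (fun y => ((f y j : ℝ) : ℂ)) x =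
      -(lv A B x) * vapp T (fun y => ((f y j : ℝ) : ℂ)) x := fun j =>
    vapp_smul_left _ _ _ _ _ (hF.commLbL A B x hx)
  have hbr : ∀ D C j, vbrk (vconj (Lh D)) (Lh C) (f x) j = -(lvh D C (f x)) * Th (f x) j :=
    fun D C j => congrFun (hFh.commLbL D C (f x) (h.maps hx)) j
  have := frE_indep hFh (h.maps hx)
    (-(∑ D, ∑ C, (starRingEnd ℂ) (γ D A x) * γ C B x * lvh D C (f x)) + lv A B x * ξ x)
    (fun C => vapp (vconj (L A)) (γ C B) x + lv A B x * η C x)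
    (fun C => - vapp (L B) (fun x => (starRingEnd ℂ) (γ C A x)) x
      + lv A B x * (starRingEnd ℂ) (η C x)) (by
    intro j
    have k1 := key j
    rw [hT j, h.pushT x hx j] at k1
    simp only [Fintype.sum_sum_type, frE, Sum.elim_inl, Sum.elim_inr, vapp_const, hbr,
      zero_mul, mul_zero, Finset.sum_const_zero, add_zero, zero_add, sub_zero, zero_sub] at k1
    have e1 : ∑ D, ∑ C, (starRingEnd ℂ) (γ D A x) * γ C B x * (-(lvh D C (f x)) * Th (f x) j) =
        -(∑ D, ∑ C, (starRingEnd ℂ) (γ D A x) * γ C B x * lvh D C (f x)) * Th (f x) j := by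
      simp only [Finset.sum_mul, ← Finset.sum_neg_distrib]
      refine Finset.sum_congr rfl fun D _ => Finset.sum_congr rfl fun C _ => ?_
      ring
    rw [e1] at k1
    simp only [add_mul, Finset.sum_add_distrib, mul_assoc, ← Finset.mul_sum] at k1 ⊢
    linear_combination -k1)
  obtain ⟨h1, h2, -⟩ := this
  refine ⟨by linear_combination -h1, fun C => by linear_combination h2 C⟩

lemma struct2 (hF : NFrame n Ω T L lv hb) (hFh : NFrame n Ωh Th Lh lvh hbh)
    (h : CRTrans n Ω Ωh T L Th Lh f γ η ξ) (A : Fin n) {x : Fin (2 * n + 1) → ℝ}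
    (hx : x ∈ Ω) :
    (vapp (vconj (L A)) (fun y => ((ξ y : ℝ) : ℂ)) x =
      (∑ D, (starRingEnd ℂ) (γ D A x) * (ξ x * hbh D (f x) + ∑ C, η C x * lvh D C (f x)))
        - hb A x * ξ x) ∧
    ∀ C, vapp (vconj (L A)) (η C) x = - (hb A x * η C x) := by
  have key := push_brk (X := vconj (L A)) (Y := T) hF.open_Ω hFh.open_Ω
    (sm_vconj (hF.smoothL A)) hF.smoothT h.smooth_f h.maps (frE Th Lh) (frE_smooth hFh)
    (Sum.elim (fun _ _ => 0) (Sum.elim (fun _ _ => 0) (fun D x => (starRingEnd ℂ) (γ D A x))))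
    (Sum.elim (fun _ x => (ξ x : ℂ))
      (Sum.elim (fun C => η C) (fun C x => (starRingEnd ℂ) (η C x))))
    (by
      rintro (k | k | k)
      · exact contDiffOn_const
      · exact contDiffOn_const
      · exact sm_conj (h.smooth_γ k A))
    (by
      rintro (k | k | k)
      · exact sm_ofReal h.smooth_ξ
      · exact h.smooth_η k
      · exact sm_conj (h.smooth_η k))
    (by
      intro x hx j
      simp [h.pushLb A x hx j, Fintype.sum_sum_type, frE])
    (by
      intro x hx j
      simp [h.pushT x hx j, Fintype.sum_sum_type, frE, add_assoc]) hx
  have hT : ∀ j, vapp (vbrk (vconj (L A)) T) (fun y => ((f y j : ℝ) : ℂ)) x =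
      -(hb A x) * vapp T (fun y => ((f y j : ℝ) : ℂ)) x := fun j =>
    vapp_smul_left _ _ _ _ _ (hF.commLbT A x hx)
  have hbr : ∀ D C j, vbrk (vconj (Lh D)) (Lh C) (f x) j = -(lvh D C (f x)) * Th (f x) j :=
    fun D C j => congrFun (hFh.commLbL D C (f x) (h.maps hx)) j
  have hbr2 : ∀ D j, vbrk (vconj (Lh D)) Th (f x) j = -(hbh D (f x)) * Th (f x) j :=
    fun D j => congrFun (hFh.commLbT D (f x) (h.maps hx)) j
  have hbr3 : ∀ D C j, vbrk (vconj (Lh D)) (vconj (Lh C)) (f x) j = 0 := by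
    intro D C j
    rw [vbrk_conj, hFh.commLL D C (f x) (h.maps hx)]
    simp
  have := frE_indep hFh (h.maps hx)
    (vapp (vconj (L A)) (fun y => ((ξ y : ℝ) : ℂ)) x -
      (∑ D, (starRingEnd ℂ) (γ D A x) * (ξ x * hbh D (f x) + ∑ C, η C x * lvh D C (f x)))
        + hb A x * ξ x)
    (fun C => vapp (vconj (L A)) (η C) x + hb A x * η C x)
    (fun C => vapp (vconj (L A)) (fun x => (starRingEnd ℂ) (η C x)) x
        - vapp T (fun x => (starRingEnd ℂ) (γ C A x)) x
      + hb A x * (starRingEnd ℂ) (η C x)) (by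
    intro j
    have k1 := key j
    rw [hT j, h.pushT x hx j] at k1
    simp only [Fintype.sum_sum_type, frE, Sum.elim_inl, Sum.elim_inr, vapp_const, hbr, hbr2, hbr3,
      zero_mul, mul_zero, Finset.sum_const_zero, add_zero, zero_add, sub_zero,
      Finset.univ_unique, Finset.sum_singleton] at k1
    have e1 : (∑ D, ((starRingEnd ℂ) (γ D A x) * ξ x * (-(hbh D (f x)) * Th (f x) j) +
        ∑ C, (starRingEnd ℂ) (γ D A x) * η C x * (-(lvh D C (f x)) * Th (f x) j))) =
        -(∑ D, (starRingEnd ℂ) (γ D A x) * (ξ x * hbh D (f x) + ∑ C, η C x * lvh D C (f x)))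
          * Th (f x) j := by
      rw [← Finset.sum_neg_distrib, Finset.sum_mul]
      refine Finset.sum_congr rfl fun D _ => ?_
      simp only [mul_add, add_mul, neg_add, Finset.mul_sum, Finset.sum_mul,
        ← Finset.sum_neg_distrib]
      congr 1
      · ring
      · refine Finset.sum_congr rfl fun C _ => ?_
        ring
    rw [e1] at k1
    simp only [add_mul, sub_mul, Finset.sum_add_distrib, Finset.sum_sub_distrib, mul_assoc,
      ← Finset.mul_sum] at k1 ⊢
    linear_combination -k1)
  obtain ⟨h1, h2, -⟩ := this
  refine ⟨by linear_combination h1, fun C => by linear_combination h2 C⟩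

lemma hTrev_cons (L : Fin n → VF (2 * n + 1)) (hb : Fin n → (Fin (2 * n + 1) → ℝ) → ℂ)
    (C : Fin n) (l : List (Fin n)) (x : Fin (2 * n + 1) → ℝ) :
    hTrev L hb (C :: l) x =
      vapp (vconj (L C)) (hTrev L hb l) x + hTrev L hb l x * hb C x := by
  cases l with
  | nil => simp [hTrev, vapp_const]
  | cons a t => simp [hTrev]

lemma hDrev_cons (L : Fin n → VF (2 * n + 1)) (lv : Fin n → Fin n → (Fin (2 * n + 1) → ℝ) → ℂ)
    (hb : Fin n → (Fin (2 * n + 1) → ℝ) → ℂ)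
    (C : Fin n) (l : List (Fin n)) (D : Fin n) (x : Fin (2 * n + 1) → ℝ) :
    hDrev L lv hb (C :: l) D x =
      vapp (vconj (L C)) (hDrev L lv hb l D) x + hTrev L hb l x * lv C D x := by
  cases l with
  | nil => simp [hDrev, hTrev, vapp_const]
  | cons a t => simp [hDrev]

lemma hTrev_smooth (hF : NFrame n Ω T L lv hb) (l : List (Fin n)) :
    ContDiffOn ℝ (⊤ : ℕ∞) (hTrev L hb l) Ω := by
  induction l with
  | nil => exact contDiffOn_const
  | cons C l ih =>
    rw [show hTrev L hb (C :: l) = _ from funext (hTrev_cons L hb C l)]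
    exact (sm_vapp hF.open_Ω (sm_vconj (hF.smoothL C)) ih).add (ih.mul (hF.smooth_hb C))

lemma hDrev_smooth (hF : NFrame n Ω T L lv hb) (l : List (Fin n)) (D : Fin n) :
    ContDiffOn ℝ (⊤ : ℕ∞) (hDrev L lv hb l D) Ω := by
  induction l with
  | nil => exact contDiffOn_const
  | cons C l ih =>
    rw [show hDrev L lv hb (C :: l) D = _ from funext (hDrev_cons L lv hb C l D)]
    exact (sm_vapp hF.open_Ω (sm_vconj (hF.smoothL C)) ih).add
      ((hTrev_smooth hF l).mul (hF.smooth_lv C D))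

/-- The quantity `G`. -/
def GG (Lh : Fin n → VF (2 * n + 1)) (lvh : Fin n → Fin n → (Fin (2 * n + 1) → ℝ) → ℂ)
    (hbh : Fin n → (Fin (2 * n + 1) → ℝ) → ℂ)
    (f : (Fin (2 * n + 1) → ℝ) → (Fin (2 * n + 1) → ℝ))
    (η : Fin n → (Fin (2 * n + 1) → ℝ) → ℂ) (ξ : (Fin (2 * n + 1) → ℝ) → ℝ)
    (l : List (Fin n)) (x : Fin (2 * n + 1) → ℝ) : ℂ :=
  ξ x * hTrev Lh hbh l (f x) + ∑ C, η C x * hDrev Lh lvh hbh l C (f x)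

/-- The quantity `F`. -/
def FF (Lh : Fin n → VF (2 * n + 1)) (lvh : Fin n → Fin n → (Fin (2 * n + 1) → ℝ) → ℂ)
    (hbh : Fin n → (Fin (2 * n + 1) → ℝ) → ℂ)
    (f : (Fin (2 * n + 1) → ℝ) → (Fin (2 * n + 1) → ℝ))
    (γ : Fin n → Fin n → (Fin (2 * n + 1) → ℝ) → ℂ)
    (l : List (Fin n)) (B : Fin n) (x : Fin (2 * n + 1) → ℝ) : ℂ :=
  ∑ C, γ C B x * hDrev Lh lvh hbh l C (f x)

lemma chain_bar (hF : NFrame n Ω T L lv hb) (hFh : NFrame n Ωh Th Lh lvh hbh)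
    (h : CRTrans n Ω Ωh T L Th Lh f γ η ξ) (E : Fin n) {x : Fin (2 * n + 1) → ℝ}
    (hx : x ∈ Ω) {u : (Fin (2 * n + 1) → ℝ) → ℂ} (hu : ContDiffOn ℝ (⊤ : ℕ∞) u Ωh) :
    vapp (vconj (L E)) (fun y => u (f y)) x =
      ∑ D, (starRingEnd ℂ) (γ D E x) * vapp (vconj (Lh D)) u (f x) :=
  vapp_comp_frame (sm_diff hF.open_Ω h.smooth_f hx) (sm_diff hFh.open_Ω hu (h.maps hx))
    (fun D => vconj (Lh D)) (fun D => (starRingEnd ℂ) (γ D E x)) (h.pushLb E x hx)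

lemma FF_rec (hF : NFrame n Ω T L lv hb) (hFh : NFrame n Ωh Th Lh lvh hbh)
    (h : CRTrans n Ω Ωh T L Th Lh f γ η ξ) (E B : Fin n) (l : List (Fin n))
    {x : Fin (2 * n + 1) → ℝ} (hx : x ∈ Ω) :
    ∑ D, (starRingEnd ℂ) (γ D E x) * FF Lh lvh hbh f γ (D :: l) B x =
      vapp (vconj (L E)) (FF Lh lvh hbh f γ l B) x + lv E B x * GG Lh lvh hbh f η ξ l x := by
  obtain ⟨s1, s2⟩ := struct1 hF hFh h E B hx
  have hd : ∀ C, DifferentiableAt ℝ (fun y => hDrev Lh lvh hbh l C (f y)) x := fun C =>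
    (sm_diff hFh.open_Ω (hDrev_smooth hFh l C) (h.maps hx)).comp x
      (sm_diff hF.open_Ω h.smooth_f hx)
  have hg : ∀ C, DifferentiableAt ℝ (γ C B) x := fun C => sm_diff hF.open_Ω (h.smooth_γ C B) hx
  have e : vapp (vconj (L E)) (FF Lh lvh hbh f γ l B) x =
      ∑ C, (-(lv E B x * η C x) * hDrev Lh lvh hbh l C (f x) + γ C B x *
        ∑ D, (starRingEnd ℂ) (γ D E x) * vapp (vconj (Lh D)) (hDrev Lh lvh hbh l C) (f x)) := by
    unfold FF
    rw [vapp_sum _ (fun C => (hg C).fun_mul (hd C))]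
    refine Finset.sum_congr rfl fun C _ => ?_
    rw [vapp_mul _ (hg C) (hd C), s2, chain_bar hF hFh h E hx (hDrev_smooth hFh l C)]
  rw [e]
  simp only [FF, GG, hDrev_cons, mul_add, Finset.sum_add_distrib, Finset.mul_sum]
  have e2 : ∑ D, ∑ C, (starRingEnd ℂ) (γ D E x) * (γ C B x * (hTrev Lh hbh l (f x) *
      lvh D C (f x))) = hTrev Lh hbh l (f x) * (lv E B x * ξ x) := by
    rw [← s1, Finset.mul_sum]
    refine Finset.sum_congr rfl fun D _ => ?_
    rw [Finset.mul_sum]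
    refine Finset.sum_congr rfl fun C _ => ?_
    ring
  rw [e2, Finset.sum_comm]
  have e3 : ∑ C, -(lv E B x * η C x) * hDrev Lh lvh hbh l C (f x) =
    - ∑ C, lv E B x * (η C x * hDrev Lh lvh hbh l C (f x)) := by
    rw [← Finset.sum_neg_distrib]
    refine Finset.sum_congr rfl fun C _ => ?_
    ring
  have e4 : ∑ C, ∑ D, (starRingEnd ℂ) (γ D E x) * (γ C B x *
        vapp (vconj (Lh D)) (hDrev Lh lvh hbh l C) (f x)) =
      ∑ C, ∑ D, γ C B x * ((starRingEnd ℂ) (γ D E x) *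
        vapp (vconj (Lh D)) (hDrev Lh lvh hbh l C) (f x)) :=
    Finset.sum_congr rfl fun C _ => Finset.sum_congr rfl fun D _ => by ring
  rw [e3, e4]
  ring

lemma GG_rec (hF : NFrame n Ω T L lv hb) (hFh : NFrame n Ωh Th Lh lvh hbh)
    (h : CRTrans n Ω Ωh T L Th Lh f γ η ξ) (E : Fin n) (l : List (Fin n))
    {x : Fin (2 * n + 1) → ℝ} (hx : x ∈ Ω) :
    ∑ D, (starRingEnd ℂ) (γ D E x) * GG Lh lvh hbh f η ξ (D :: l) x =
      vapp (vconj (L E)) (GG Lh lvh hbh f η ξ l) x + hb E x * GG Lh lvh hbh f η ξ l x := by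
  obtain ⟨s1, s2⟩ := struct2 hF hFh h E hx
  have hd : ∀ C, DifferentiableAt ℝ (fun y => hDrev Lh lvh hbh l C (f y)) x := fun C =>
    (sm_diff hFh.open_Ω (hDrev_smooth hFh l C) (h.maps hx)).comp x
      (sm_diff hF.open_Ω h.smooth_f hx)
  have hd' : DifferentiableAt ℝ (fun y => hTrev Lh hbh l (f y)) x :=
    (sm_diff hFh.open_Ω (hTrev_smooth hFh l) (h.maps hx)).comp x
      (sm_diff hF.open_Ω h.smooth_f hx)
  have hg : ∀ C, DifferentiableAt ℝ (η C) x := fun C => sm_diff hF.open_Ω (h.smooth_η C) hx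
  have hξ : DifferentiableAt ℝ (fun y => ((ξ y : ℝ) : ℂ)) x :=
    sm_diff hF.open_Ω (sm_ofReal h.smooth_ξ) hx
  have e : vapp (vconj (L E)) (GG Lh lvh hbh f η ξ l) x =
      vapp (vconj (L E)) (fun y => ((ξ y : ℝ) : ℂ)) x * hTrev Lh hbh l (f x) +
       ξ x * (∑ D, (starRingEnd ℂ) (γ D E x) * vapp (vconj (Lh D)) (hTrev Lh hbh l) (f x)) +
      ∑ C, (-(hb E x * η C x) * hDrev Lh lvh hbh l C (f x) + η C x *
        ∑ D, (starRingEnd ℂ) (γ D E x) * vapp (vconj (Lh D)) (hDrev Lh lvh hbh l C) (f x)) := by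
    unfold GG
    rw [vapp_add _ (hξ.fun_mul hd') (DifferentiableAt.fun_sum fun C _ => (hg C).fun_mul (hd C)),
      vapp_mul _ hξ hd', chain_bar hF hFh h E hx (hTrev_smooth hFh l),
      vapp_sum _ (fun C => (hg C).fun_mul (hd C))]
    congr 1
    refine Finset.sum_congr rfl fun C _ => ?_
    rw [vapp_mul _ (hg C) (hd C), s2, chain_bar hF hFh h E hx (hDrev_smooth hFh l C)]
  rw [e, s1]
  have e0 : ∀ D, (starRingEnd ℂ) (γ D E x) * GG Lh lvh hbh f η ξ (D :: l) x =
      ξ x * ((starRingEnd ℂ) (γ D E x) * vapp (vconj (Lh D)) (hTrev Lh hbh l) (f x)) +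
      (starRingEnd ℂ) (γ D E x) * (ξ x * hbh D (f x) + ∑ C, η C x * lvh D C (f x))
        * hTrev Lh hbh l (f x) +
      ∑ C, η C x *
        ((starRingEnd ℂ) (γ D E x) * vapp (vconj (Lh D)) (hDrev Lh lvh hbh l C) (f x)) := by
    intro D
    simp only [GG, hDrev_cons, hTrev_cons, mul_add, add_mul, Finset.sum_add_distrib,
      Finset.mul_sum, Finset.sum_mul]
    have a1 : ∑ C, (starRingEnd ℂ) (γ D E x) * (η C x * (hTrev Lh hbh l (f x) * lvh D C (f x))) =
      ∑ C, (starRingEnd ℂ) (γ D E x) * (η C x * lvh D C (f x)) * hTrev Lh hbh l (f x) :=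
      Finset.sum_congr rfl fun C _ => by ring
    have a2 : ∑ C, (starRingEnd ℂ) (γ D E x) *
        (η C x * vapp (vconj (Lh D)) (hDrev Lh lvh hbh l C) (f x)) = ∑ C, η C x *
        ((starRingEnd ℂ) (γ D E x) * vapp (vconj (Lh D)) (hDrev Lh lvh hbh l C) (f x)) :=
      Finset.sum_congr rfl fun C _ => by ring
    rw [a1, a2]
    ring
  have e3 : ∑ C, -(hb E x * η C x) * hDrev Lh lvh hbh l C (f x) =
    - (hb E x * ∑ C, (η C x * hDrev Lh lvh hbh l C (f x))) := by
    rw [Finset.mul_sum, ← Finset.sum_neg_distrib]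
    refine Finset.sum_congr rfl fun C _ => ?_
    ring
  simp only [e0, Finset.sum_add_distrib, e3]
  rw [Finset.sum_comm]
  simp only [← Finset.mul_sum, ← Finset.sum_mul, GG]
  ring

end Struct

section Rat

/-- A CR diffeomorphism with its data. -/
structure CRD (n : ℕ) (Ω Ωh : Set (Fin (2 * n + 1) → ℝ))
    (T : VF (2 * n + 1)) (L : Fin n → VF (2 * n + 1))
    (Th : VF (2 * n + 1)) (Lh : Fin n → VF (2 * n + 1)) where
  f : (Fin (2 * n + 1) → ℝ) → (Fin (2 * n + 1) → ℝ)
  γ : Fin n → Fin n → (Fin (2 * n + 1) → ℝ) → ℂ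
  η : Fin n → (Fin (2 * n + 1) → ℝ) → ℂ
  ξ : (Fin (2 * n + 1) → ℝ) → ℝ
  h : CRTrans n Ω Ωh T L Th Lh f γ η ξ

variable {n : ℕ} {Ω Ωh : Set (Fin (2 * n + 1) → ℝ)}
    {T : VF (2 * n + 1)} {L : Fin n → VF (2 * n + 1)}
    {lv : Fin n → Fin n → (Fin (2 * n + 1) → ℝ) → ℂ}
    {hb : Fin n → (Fin (2 * n + 1) → ℝ) → ℂ}
    {Th : VF (2 * n + 1)} {Lh : Fin n → VF (2 * n + 1)}
    {lvh : Fin n → Fin n → (Fin (2 * n + 1) → ℝ) → ℂ}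
    {hbh : Fin n → (Fin (2 * n + 1) → ℝ) → ℂ}

/-- The conjugate matrix of `γ`. -/
def mg (d : CRD n Ω Ωh T L Th Lh) (x : Fin (2 * n + 1) → ℝ) : Matrix (Fin n) (Fin n) ℂ :=
  Matrix.of fun D E => (starRingEnd ℂ) (d.γ D E x)

/-- Its determinant. -/
def dg (d : CRD n Ω Ωh T L Th Lh) (x : Fin (2 * n + 1) → ℝ) : ℂ := (mg d x).det

lemma dg_ne (d : CRD n Ω Ωh T L Th Lh) {x : Fin (2 * n + 1) → ℝ} (hx : x ∈ Ω) : dg d x ≠ 0 := by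
  have h := (Matrix.isUnit_iff_isUnit_det _).1 (d.h.γ_inv x hx)
  have e : mg d x = (starRingEnd ℂ).mapMatrix (Matrix.of fun A B => d.γ A B x) := by
    ext; simp [mg]
  rw [dg, e, ← RingHom.map_det]
  simpa using h.ne_zero

/-- Rational families. The flag `b` says whether inverses of the determinant are allowed. -/
inductive RF (b : Prop) : ℕ → (CRD n Ω Ωh T L Th Lh → (Fin (2 * n + 1) → ℝ) → ℂ) → Prop
  | coef (k : ℕ) (c : (Fin (2 * n + 1) → ℝ) → ℂ) (hc : ContDiffOn ℝ (⊤ : ℕ∞) c Ω) :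
      RF b k (fun _ x => c x)
  | vγ (k : ℕ) (C A : Fin n) (J : List (Fin n)) (hJ : J.length + 1 ≤ k) :
      RF b k (fun d x => (starRingEnd ℂ) (appOp L J (d.γ C A) x))
  | vξ (k : ℕ) (I : List (Fin n)) (hI : I.length ≤ k) :
      RF b k (fun d x => (starRingEnd ℂ) (appOp L I (fun y => ((d.ξ y : ℝ) : ℂ)) x))
  | inv (k : ℕ) (hk : 1 ≤ k) (hb : b) : RF b k (fun d x => (dg d x)⁻¹)
  | add (k : ℕ) (Φ Ψ : CRD n Ω Ωh T L Th Lh → (Fin (2 * n + 1) → ℝ) → ℂ) (h1 : RF b k Φ)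
      (h2 : RF b k Ψ) : RF b k (fun d x => Φ d x + Ψ d x)
  | mul (k : ℕ) (Φ Ψ : CRD n Ω Ωh T L Th Lh → (Fin (2 * n + 1) → ℝ) → ℂ) (h1 : RF b k Φ)
      (h2 : RF b k Ψ) : RF b k (fun d x => Φ d x * Ψ d x)
  | congr (k : ℕ) (Φ Ψ : CRD n Ω Ωh T L Th Lh → (Fin (2 * n + 1) → ℝ) → ℂ) (h1 : RF b k Φ)
      (h2 : ∀ d, ∀ x ∈ Ω, Φ d x = Ψ d x) : RF b k Ψ

variable {b : Prop} {k : ℕ} {Φ Ψ : CRD n Ω Ωh T L Th Lh → (Fin (2 * n + 1) → ℝ) → ℂ}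

lemma RF.mono {b' : Prop} (hb' : b → b') {k' : ℕ} (hk : k ≤ k') (h : RF b k Φ) : RF b' k' Φ := by
  induction h with
  | coef c hc => exact RF.coef _ c hc
  | vγ C A J hJ => exact RF.vγ _ C A J (hJ.trans hk)
  | vξ I hI => exact RF.vξ _ I (hI.trans hk)
  | inv h1 hb => exact RF.inv _ (h1.trans hk) (hb' hb)
  | add Φ Ψ _ _ i1 i2 => exact RF.add _ _ _ i1 i2
  | mul Φ Ψ _ _ i1 i2 => exact RF.mul _ _ _ i1 i2
  | congr Φ Ψ _ h2 i1 => exact RF.congr _ _ _ i1 h2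

lemma RF.const (c : ℂ) : RF b k (fun (_ : CRD n Ω Ωh T L Th Lh) _ => c) :=
  RF.coef k (fun _ => c) contDiffOn_const

lemma RF.sum {ι : Type*} (s : Finset ι)
    (Φ : ι → CRD n Ω Ωh T L Th Lh → (Fin (2 * n + 1) → ℝ) → ℂ) (h : ∀ i, RF b k (Φ i)) :
    RF b k (fun d x => ∑ i ∈ s, Φ i d x) := by
  classical
  induction s using Finset.induction_on with
  | empty => simpa using RF.const 0
  | insert a s ha ih =>
    simp only [Finset.sum_insert ha]
    exact RF.add _ _ _ (h a) ih

lemma RF.prod {ι : Type*} (s : Finset ι)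
    (Φ : ι → CRD n Ω Ωh T L Th Lh → (Fin (2 * n + 1) → ℝ) → ℂ) (h : ∀ i, RF b k (Φ i)) :
    RF b k (fun d x => ∏ i ∈ s, Φ i d x) := by
  classical
  induction s using Finset.induction_on with
  | empty => simpa using RF.const 1
  | insert a s ha ih =>
    simp only [Finset.prod_insert ha]
    exact RF.mul _ _ _ (h a) ih

lemma RF.det (M : CRD n Ω Ωh T L Th Lh → (Fin (2 * n + 1) → ℝ) → Matrix (Fin n) (Fin n) ℂ)
    (h : ∀ i j, RF b k (fun d x => M d x i j)) : RF b k (fun d x => (M d x).det) := by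
  simp only [Matrix.det_apply']
  exact RF.sum _ _ fun σ => RF.mul _ _ _ (RF.const _) (RF.prod _ _ fun i => h _ _)

lemma RF.mg (D E : Fin n) : RF b (k + 1) (fun (d : CRD n Ω Ωh T L Th Lh) x => mg d x D E) :=
  RF.vγ (k + 1) D E [] (by simp)

lemma RF.dg : RF b (k + 1) (fun (d : CRD n Ω Ωh T L Th Lh) x => dg d x) :=
  RF.det _ fun D E => RF.mg D E

lemma RF.mginv (D E : Fin n) :
    RF True (k + 1) (fun (d : CRD n Ω Ωh T L Th Lh) x => (_root_.mg d x)⁻¹ D E) := by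
  simp only [Matrix.inv_def, Matrix.smul_apply, Ring.inverse_eq_inv', smul_eq_mul]
  refine RF.mul _ _ _ (RF.inv _ (by omega) trivial) ?_
  simp only [Matrix.adjugate_apply]
  refine RF.det _ fun i j => ?_
  simp only [Matrix.updateRow_apply]
  split_ifs
  · exact RF.const _
  · exact RF.mg i j

lemma appOp_smooth (hF : NFrame n Ω T L lv hb) {u : (Fin (2 * n + 1) → ℝ) → ℂ}
    (hu : ContDiffOn ℝ (⊤ : ℕ∞) u Ω) (J : List (Fin n)) :
    ContDiffOn ℝ (⊤ : ℕ∞) (appOp L J u) Ω := by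
  induction J with
  | nil => exact hu
  | cons j J ih => exact sm_vapp hF.open_Ω (hF.smoothL j) ih

lemma RF.smooth (hF : NFrame n Ω T L lv hb) (h : RF b k Φ) (d : CRD n Ω Ωh T L Th Lh) :
    ContDiffOn ℝ (⊤ : ℕ∞) (Φ d) Ω := by
  induction h with
  | coef c hc => exact hc
  | vγ C A J hJ => exact sm_conj (appOp_smooth hF (d.h.smooth_γ C A) J)
  | vξ I hI => exact sm_conj (appOp_smooth hF (sm_ofReal d.h.smooth_ξ) I)
  | inv h1 hb =>
    refine ContDiffOn.inv ?_ (fun x hx => dg_ne d hx)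
    unfold _root_.dg
    simp only [Matrix.det_apply']
    refine ContDiffOn.sum fun σ _ => contDiffOn_const.mul (contDiffOn_prod fun i _ => ?_)
    exact sm_conj (d.h.smooth_γ _ _)
  | add Φ Ψ _ _ i1 i2 => exact i1.add i2
  | mul Φ Ψ _ _ i1 i2 => exact i1.mul i2
  | congr Φ Ψ _ h2 i1 => exact i1.congr fun x hx => (h2 d x hx).symm

lemma RF.deriv_aux (hF : NFrame n Ω T L lv hb) (E : Fin n)
    (hdet : b → RF b 2 (fun (d : CRD n Ω Ωh T L Th Lh) => vapp (vconj (L E)) (_root_.dg d)))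
    (h : RF b k Φ) : RF b (k + 1) (fun d => vapp (vconj (L E)) (Φ d)) := by
  induction h with
  | coef c hc =>
    exact RF.coef _ _ (sm_vapp hF.open_Ω (sm_vconj (hF.smoothL E)) hc)
  | vγ C A J hJ =>
    refine RF.congr _ _ _ (RF.vγ (k + 1) C A (E :: J) (by simpa using hJ)) fun d x _ => ?_
    rw [vapp_conj]; rfl
  | vξ I hI =>
    refine RF.congr _ _ _ (RF.vξ (k + 1) (E :: I) (by simpa using hI)) fun d x _ => ?_
    rw [vapp_conj]; rfl
  | inv h1 hb =>
    have hi : RF b (k + 1) (fun (d : CRD n Ω Ωh T L Th Lh) x => (_root_.dg d x)⁻¹) :=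
      RF.inv (k + 1) (by omega) hb
    refine RF.congr _ _ _ (RF.mul _ _ _ (RF.const (-1)) (RF.mul _ _ _ (RF.mul _ _ _ hi hi)
      ((hdet hb).mono id (by omega)))) fun d x hx => ?_
    rw [vapp_inv _ (sm_diff hF.open_Ω ((RF.dg (b := b) (k := 0)).smooth hF d) hx) (dg_ne d hx)]
    ring
  | add Φ Ψ h1 h2 i1 i2 =>
    refine RF.congr _ _ _ (RF.add _ _ _ i1 i2) fun d x hx => ?_
    rw [vapp_add _ (sm_diff hF.open_Ω (h1.smooth hF d) hx)
      (sm_diff hF.open_Ω (h2.smooth hF d) hx)]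
  | mul Φ Ψ h1 h2 i1 i2 =>
    refine RF.congr _ _ _ (RF.add _ _ _ (RF.mul _ _ _ i1 (h2.mono id (by omega)))
      (RF.mul _ _ _ (h1.mono id (by omega)) i2)) fun d x hx => ?_
    rw [vapp_mul _ (sm_diff hF.open_Ω (h1.smooth hF d) hx)
      (sm_diff hF.open_Ω (h2.smooth hF d) hx)]
  | congr Φ Ψ h1 h2 i1 =>
    exact RF.congr _ _ _ i1 fun d x hx => vapp_congr_on hF.open_Ω (h2 d) hx

lemma RF.deriv (hF : NFrame n Ω T L lv hb) (E : Fin n)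
    (h : RF True k Φ) : RF True (k + 1) (fun d => vapp (vconj (L E)) (Φ d)) :=
  RF.deriv_aux hF E (fun _ => (RF.deriv_aux (b := False) hF E (fun h => h.elim)
    (RF.dg (k := 0))).mono (fun h => h.elim) le_rfl) h

/-- Solve the linear system with matrix `mg`. -/
lemma RF.solve (Q : Fin n → CRD n Ω Ωh T L Th Lh → (Fin (2 * n + 1) → ℝ) → ℂ)
    (Y : Fin n → CRD n Ω Ωh T L Th Lh → (Fin (2 * n + 1) → ℝ) → ℂ)
    (hQ : ∀ E, RF True (k + 1) (Q E))
    (hY : ∀ d, ∀ x ∈ Ω, ∀ E, ∑ D, (starRingEnd ℂ) (d.γ D E x) * Y D d x = Q E d x)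
    (D : Fin n) : RF True (k + 1) (Y D) := by
  refine RF.congr _ _ _ (RF.sum Finset.univ _ fun E =>
    RF.mul _ _ _ (hQ E) (RF.mginv E D)) fun d x hx => ?_
  have h1 : Matrix.vecMul (fun D => Y D d x) (_root_.mg d x) = fun E => Q E d x := by
    ext E
    rw [← hY d x hx E]
    simp [Matrix.vecMul, dotProduct, _root_.mg, mul_comm]
  have h2 : Matrix.vecMul (fun E => Q E d x) (_root_.mg d x)⁻¹ = fun D => Y D d x := by
    rw [← h1, Matrix.vecMul_vecMul, Matrix.mul_nonsing_inv _ (dg_ne d hx).isUnit,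
      Matrix.vecMul_one]
  have := congrFun h2 D
  simpa [Matrix.vecMul, dotProduct] using this

lemma RF.FG (hF : NFrame n Ω T L lv hb) (hFh : NFrame n Ωh Th Lh lvh hbh) (l : List (Fin n)) :
    (∀ B, RF True l.length
      (fun (d : CRD n Ω Ωh T L Th Lh) => FF Lh lvh hbh d.f d.γ l B)) ∧
    RF True l.length (fun (d : CRD n Ω Ωh T L Th Lh) => GG Lh lvh hbh d.f d.η d.ξ l) := by
  induction l with
  | nil =>
    constructor
    · intro B
      refine RF.congr _ _ _ (RF.const 0) fun d x _ => ?_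
      simp [FF, hDrev]
    · refine RF.congr _ _ _ (RF.vξ _ [] (by simp)) fun d x _ => ?_
      simp [GG, hDrev, hTrev, appOp]
  | cons D l ih =>
    obtain ⟨ih1, ih2⟩ := ih
    constructor
    · intro B
      exact RF.solve (fun E d x => vapp (vconj (L E)) (FF Lh lvh hbh d.f d.γ l B) x +
          lv E B x * GG Lh lvh hbh d.f d.η d.ξ l x)
        (fun D d x => FF Lh lvh hbh d.f d.γ (D :: l) B x)
        (fun E => RF.add _ _ _ ((ih1 B).deriv hF E) (RF.mul _ _ _
          (RF.coef _ _ (hF.smooth_lv E B)) (ih2.mono id (by omega))))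
        (fun d x hx E => FF_rec hF hFh d.h E B l hx) D
    · exact RF.solve (fun E d x => vapp (vconj (L E)) (GG Lh lvh hbh d.f d.η d.ξ l) x +
          hb E x * GG Lh lvh hbh d.f d.η d.ξ l x)
        (fun D d x => GG Lh lvh hbh d.f d.η d.ξ (D :: l) x)
        (fun E => RF.add _ _ _ (ih2.deriv hF E) (RF.mul _ _ _
          (RF.coef _ _ (hF.smooth_hb E)) (ih2.mono id (by omega))))
        (fun d x hx E => GG_rec hF hFh d.h E l hx) D

end Rat

section Fin

variable {n : ℕ} {Ω Ωh : Set (Fin (2 * n + 1) → ℝ)}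
    {T : VF (2 * n + 1)} {L : Fin n → VF (2 * n + 1)}
    {lv : Fin n → Fin n → (Fin (2 * n + 1) → ℝ) → ℂ}
    {hb : Fin n → (Fin (2 * n + 1) → ℝ) → ℂ}
    {Th : VF (2 * n + 1)} {Lh : Fin n → VF (2 * n + 1)}
    {lvh : Fin n → Fin n → (Fin (2 * n + 1) → ℝ) → ℂ}
    {hbh : Fin n → (Fin (2 * n + 1) → ℝ) → ℂ}

lemma exists_det_ne (S : Set (Fin n → ℂ))
    (h : ∀ v : Fin n → ℂ, (∀ w ∈ S, ∑ a, v a * w a = 0) → v = 0) :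
    ∃ g : Fin n → Fin n → ℂ, (∀ i, g i ∈ S) ∧ (Matrix.of g).det ≠ 0 := by
  have hspan : Submodule.span ℂ S = ⊤ := by
    by_contra hne
    obtain ⟨φ, hφ, hle⟩ := Submodule.exists_le_ker_of_lt_top _ (lt_top_iff_ne_top.2 hne)
    have hφe : ∀ w : Fin n → ℂ, φ w = ∑ a, φ (Pi.single a 1) * w a := by
      intro w
      rw [LinearMap.pi_apply_eq_sum_univ φ w]
      refine Finset.sum_congr rfl fun a _ => ?_
      rw [smul_eq_mul, mul_comm]
      congr 2
      ext j
      simp [Pi.single_apply, eq_comm]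
    have h0 := h (fun a => φ (Pi.single a 1)) (by
      intro w hw
      rw [← hφe w]
      exact hle (Submodule.subset_span hw))
    apply hφ
    ext a
    simpa using congrFun h0 a
  obtain ⟨g, hg, -, hli⟩ := Submodule.exists_fun_fin_finrank_span_eq ℂ S
  have hfr : Module.finrank ℂ (Submodule.span ℂ S) = n := by
    rw [hspan]; simp
  refine ⟨fun i => g (Fin.cast hfr.symm i), fun i => hg _, ?_⟩
  have hli2 : LinearIndependent ℂ (fun i => g (Fin.cast hfr.symm i)) :=
    hli.comp _ (Fin.cast_injective _)
  have := Matrix.linearIndependent_rows_iff_isUnit.1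
    (show LinearIndependent ℂ (Matrix.of fun i => g (Fin.cast hfr.symm i)).row from hli2)
  exact ((Matrix.isUnit_iff_isUnit_det _).1 this).ne_zero

/-- Polynomials with smooth coefficients. -/
def PS (σ : Type*) (Ω Ωh : Set (Fin (2 * n + 1) → ℝ)) : Subring (MvPolynomial σ (CoefR n)) where
  carrier := {P | ∀ d, ContDiffOn ℝ (⊤ : ℕ∞) (MvPolynomial.coeff d P) (Ω ×ˢ Ωh)}
  zero_mem' := fun d => by
    rw [MvPolynomial.coeff_zero]; exact contDiffOn_const
  one_mem' := fun d => by
    classical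
    rw [MvPolynomial.coeff_one]
    split_ifs <;> exact contDiffOn_const
  add_mem' := fun {P Q} hP hQ d => by
    rw [MvPolynomial.coeff_add]; exact (hP d).add (hQ d)
  neg_mem' := fun {P} hP d => by
    rw [MvPolynomial.coeff_neg]; exact (hP d).neg
  mul_mem' := fun {P Q} hP hQ d => by
    classical
    rw [MvPolynomial.coeff_mul, Finset.sum_fn]
    exact ContDiffOn.sum fun i _ => (hP _).mul (hQ _)

lemma PS_C {σ : Type*} {c : CoefR n} (hc : ContDiffOn ℝ (⊤ : ℕ∞) c (Ω ×ˢ Ωh)) :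
    MvPolynomial.C c ∈ PS σ Ω Ωh := fun d => by
  classical
  rw [MvPolynomial.coeff_C]
  split_ifs
  · exact hc
  · exact contDiffOn_const

lemma PS_X {σ : Type*} (i : σ) : (MvPolynomial.X i : MvPolynomial σ (CoefR n)) ∈ PS σ Ω Ωh :=
  fun d => by
  classical
  rw [MvPolynomial.coeff_X]
  split_ifs <;> exact contDiffOn_const

lemma PS_det {σ : Type*} (M : Matrix (Fin n) (Fin n) (MvPolynomial σ (CoefR n)))
    (h : ∀ i j, M i j ∈ PS σ Ω Ωh) : M.det ∈ PS σ Ω Ωh := by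
  rw [Matrix.det_apply']
  exact Subring.sum_mem _ fun s _ => Subring.mul_mem _ (intCast_mem _ _)
    (Subring.prod_mem _ fun i _ => h _ _)

/-- determinant polynomial -/
def detP (n k₀ : ℕ) : MvPolynomial (PolyVarγ n k₀) (CoefR n) :=
  Matrix.det (Matrix.of fun D E => MvPolynomial.X (D, E, ⟨[], by simp⟩))

lemma detP_mem (k₀ : ℕ) : detP n k₀ ∈ PS (PolyVarγ n k₀) Ω Ωh :=
  PS_det _ fun _ _ => PS_X _

lemma eval_detP (k₀ : ℕ) (d : CRD n Ω Ωh T L Th Lh) (x : Fin (2 * n + 1) → ℝ) :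
    evalγ L d.γ d.f (detP n k₀) x = dg d x := by
  have : ∀ P : MvPolynomial (PolyVarγ n k₀) (CoefR n), evalγ L d.γ d.f P x =
    MvPolynomial.eval₂Hom (Pi.evalRingHom (fun _ => ℂ) (x, d.f x))
      (fun v : PolyVarγ n k₀ => (starRingEnd ℂ) (appOp L v.2.2.1 (d.γ v.1 v.2.1) x)) P :=
    fun P => rfl
  rw [this, detP, RingHom.map_det, dg]
  congr 1
  ext D E
  simp [mg, appOp]

/-- determinant polynomial, in all variables -/
def detP2 (n k₀ : ℕ) : MvPolynomial (PolyVar n k₀) (CoefR n) :=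
  Matrix.det (Matrix.of fun D E => MvPolynomial.X (Sum.inl (D, E, ⟨[], by simp⟩)))

lemma detP2_mem (k₀ : ℕ) : detP2 n k₀ ∈ PS (PolyVar n k₀) Ω Ωh :=
  PS_det _ fun _ _ => PS_X _

lemma eval_detP2 (k₀ : ℕ) (d : CRD n Ω Ωh T L Th Lh) (x : Fin (2 * n + 1) → ℝ) :
    evalγξ L d.γ d.ξ d.f (detP2 n k₀) x = dg d x := by
  have : ∀ P : MvPolynomial (PolyVar n k₀) (CoefR n), evalγξ L d.γ d.ξ d.f P x =
    MvPolynomial.eval₂Hom (Pi.evalRingHom (fun _ => ℂ) (x, d.f x))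
      (Sum.elim (fun v => (starRingEnd ℂ) (appOp L v.2.2.1 (d.γ v.1 v.2.1) x))
      (fun I => (starRingEnd ℂ) (appOp L I.1 (fun y => ((d.ξ y : ℝ) : ℂ)) x))) P :=
    fun P => rfl
  rw [this, detP2, RingHom.map_det, dg]
  congr 1
  ext D E
  simp [mg, appOp]

/-- Families represented by polynomials up to powers of the determinant. -/
def PRep (k₀ : ℕ) (Φ : CRD n Ω Ωh T L Th Lh → (Fin (2 * n + 1) → ℝ) → ℂ) : Prop :=
  ∃ (N : ℕ) (P : MvPolynomial (PolyVar n k₀) (CoefR n)), P ∈ PS (PolyVar n k₀) Ω Ωh ∧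
    ∀ d : CRD n Ω Ωh T L Th Lh, ∀ x ∈ Ω, dg d x ^ N * Φ d x = evalγξ L d.γ d.ξ d.f P x

variable {k₀ : ℕ} {Φ Ψ : CRD n Ω Ωh T L Th Lh → (Fin (2 * n + 1) → ℝ) → ℂ}

lemma PRep.coef {c : CoefR n} (hc : ContDiffOn ℝ (⊤ : ℕ∞) c (Ω ×ˢ Ωh)) :
    PRep k₀ (fun (d : CRD n Ω Ωh T L Th Lh) x => c (x, d.f x)) :=
  ⟨0, MvPolynomial.C c, PS_C hc, fun d x _ => by simp [evalγξ]⟩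

lemma PRep.var (i : PolyVar n k₀) :
    PRep k₀ (fun (d : CRD n Ω Ωh T L Th Lh) x => evalγξ L d.γ d.ξ d.f (MvPolynomial.X i) x) :=
  ⟨0, MvPolynomial.X i, PS_X i, fun d x _ => by simp⟩

lemma evalγξ_add {γ : Fin n → Fin n → (Fin (2 * n + 1) → ℝ) → ℂ}
    {ξ : (Fin (2 * n + 1) → ℝ) → ℝ} {f : (Fin (2 * n + 1) → ℝ) → (Fin (2 * n + 1) → ℝ)}
    (P Q : MvPolynomial (PolyVar n k₀) (CoefR n)) (x : Fin (2 * n + 1) → ℝ) :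
    evalγξ L γ ξ f (P + Q) x = evalγξ L γ ξ f P x + evalγξ L γ ξ f Q x :=
  MvPolynomial.eval₂_add _ _

lemma evalγξ_mul {γ : Fin n → Fin n → (Fin (2 * n + 1) → ℝ) → ℂ}
    {ξ : (Fin (2 * n + 1) → ℝ) → ℝ} {f : (Fin (2 * n + 1) → ℝ) → (Fin (2 * n + 1) → ℝ)}
    (P Q : MvPolynomial (PolyVar n k₀) (CoefR n)) (x : Fin (2 * n + 1) → ℝ) :
    evalγξ L γ ξ f (P * Q) x = evalγξ L γ ξ f P x * evalγξ L γ ξ f Q x :=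
  MvPolynomial.eval₂_mul _ _

lemma evalγξ_pow {γ : Fin n → Fin n → (Fin (2 * n + 1) → ℝ) → ℂ}
    {ξ : (Fin (2 * n + 1) → ℝ) → ℝ} {f : (Fin (2 * n + 1) → ℝ) → (Fin (2 * n + 1) → ℝ)}
    (P : MvPolynomial (PolyVar n k₀) (CoefR n)) (N : ℕ) (x : Fin (2 * n + 1) → ℝ) :
    evalγξ L γ ξ f (P ^ N) x = evalγξ L γ ξ f P x ^ N :=
  MvPolynomial.eval₂_pow _ _

lemma PRep.add (h1 : PRep k₀ Φ) (h2 : PRep k₀ Ψ) : PRep k₀ (fun d x => Φ d x + Ψ d x) := by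
  obtain ⟨N, P, hP, eP⟩ := h1
  obtain ⟨M, Q, hQ, eQ⟩ := h2
  refine ⟨N + M, P * detP2 n k₀ ^ M + Q * detP2 n k₀ ^ N, Subring.add_mem _
    (Subring.mul_mem _ hP (Subring.pow_mem _ (detP2_mem k₀) _))
    (Subring.mul_mem _ hQ (Subring.pow_mem _ (detP2_mem k₀) _)), fun d x hx => ?_⟩
  rw [evalγξ_add, evalγξ_mul, evalγξ_mul, evalγξ_pow, evalγξ_pow, eval_detP2, ← eP d x hx,
    ← eQ d x hx]
  ring

lemma PRep.mul (h1 : PRep k₀ Φ) (h2 : PRep k₀ Ψ) : PRep k₀ (fun d x => Φ d x * Ψ d x) := by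
  obtain ⟨N, P, hP, eP⟩ := h1
  obtain ⟨M, Q, hQ, eQ⟩ := h2
  refine ⟨N + M, P * Q, Subring.mul_mem _ hP hQ, fun d x hx => ?_⟩
  rw [evalγξ_mul, ← eP d x hx, ← eQ d x hx]
  ring

lemma PRep.congr (h1 : PRep k₀ Φ) (h2 : ∀ d, ∀ x ∈ Ω, Φ d x = Ψ d x) : PRep k₀ Ψ := by
  obtain ⟨N, P, hP, eP⟩ := h1
  exact ⟨N, P, hP, fun d x hx => by rw [← h2 d x hx, eP d x hx]⟩

lemma PRep.sum {ι : Type*} (s : Finset ι)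
    (Φ : ι → CRD n Ω Ωh T L Th Lh → (Fin (2 * n + 1) → ℝ) → ℂ) (h : ∀ i, PRep k₀ (Φ i)) :
    PRep k₀ (fun d x => ∑ i ∈ s, Φ i d x) := by
  classical
  induction s using Finset.induction_on with
  | empty => simpa using PRep.coef (c := fun _ => 0) contDiffOn_const
  | insert a s ha ih =>
    simp only [Finset.sum_insert ha]
    exact (h a).add ih

lemma RF.rep {b : Prop} {k : ℕ} (hk : k ≤ k₀) (h : RF b k Φ) : PRep k₀ Φ := by
  induction h with
  | coef c hc =>
    exact PRep.coef (c := fun p => c p.1) (hc.comp contDiffOn_fst fun p hp => hp.1)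
  | vγ C A J hJ =>
    refine (PRep.var (Sum.inl (C, A, ⟨J, by omega⟩))).congr fun d x _ => ?_
    simp [evalγξ]
  | vξ I hI =>
    refine (PRep.var (Sum.inr ⟨I, by omega⟩)).congr fun d x _ => ?_
    simp [evalγξ]
  | inv h1 hb =>
    refine ⟨1, 1, Subring.one_mem _, fun d x hx => ?_⟩
    simp [evalγξ, mul_inv_cancel₀ (dg_ne d hx)]
  | add Φ Ψ _ _ i1 i2 => exact i1.add i2
  | mul Φ Ψ _ _ i1 i2 => exact i1.mul i2
  | congr Φ Ψ _ h2 i1 => exact i1.congr h2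

lemma coef_hat {c : (Fin (2 * n + 1) → ℝ) → ℂ} (hc : ContDiffOn ℝ (⊤ : ℕ∞) c Ωh) :
    ContDiffOn ℝ (⊤ : ℕ∞) (fun p : (Fin (2 * n + 1) → ℝ) × (Fin (2 * n + 1) → ℝ) => c p.2)
      (Ω ×ˢ Ωh) :=
  hc.comp contDiffOn_snd fun p hp => hp.2

lemma sm_det {M : (Fin (2 * n + 1) → ℝ) → Matrix (Fin n) (Fin n) ℂ}
    (h : ∀ i j, ContDiffOn ℝ (⊤ : ℕ∞) (fun x => M x i j) Ωh) :
    ContDiffOn ℝ (⊤ : ℕ∞) (fun x => (M x).det) Ωh := by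
  simp only [Matrix.det_apply']
  exact ContDiffOn.sum fun σ _ => contDiffOn_const.mul (contDiffOn_prod fun i _ => h _ _)

lemma sm_adj {M : (Fin (2 * n + 1) → ℝ) → Matrix (Fin n) (Fin n) ℂ}
    (h : ∀ i j, ContDiffOn ℝ (⊤ : ℕ∞) (fun x => M x i j) Ωh) (i j : Fin n) :
    ContDiffOn ℝ (⊤ : ℕ∞) (fun x => (M x).adjugate i j) Ωh := by
  simp only [Matrix.adjugate_apply]
  refine sm_det fun a b => ?_
  simp only [Matrix.updateRow_apply]
  split_ifs
  · exact contDiffOn_const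
  · exact h a b

lemma adj_solve (M : Matrix (Fin n) (Fin n) ℂ) (v : Fin n → ℂ) (D : Fin n) :
    ∑ i, M.adjugate D i * (∑ C, v C * M i C) = v D * M.det := by
  have h := congrArg (fun A => Matrix.mulVec A v D) (Matrix.adjugate_mul M)
  simp only [← Matrix.mulVec_mulVec, Matrix.smul_mulVec, Matrix.one_mulVec, Pi.smul_apply,
    smul_eq_mul] at h
  rw [mul_comm, ← h]
  simp [Matrix.mulVec, dotProduct, mul_comm]

/-- The final assembly from representability. -/
lemma assemble (Hd : (Fin (2 * n + 1) → ℝ) → ℂ) (hHd : ContDiffOn ℝ (⊤ : ℕ∞) Hd Ωh)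
    (w : CRD n Ω Ωh T L Th Lh → (Fin (2 * n + 1) → ℝ) → ℂ)
    (h : PRep k₀ (fun d x => w d x * Hd (d.f x))) :
    ∃ (num : MvPolynomial (PolyVar n k₀) (CoefR n))
      (den : MvPolynomial (PolyVarγ n k₀) (CoefR n)),
      num ∈ PS (PolyVar n k₀) Ω Ωh ∧ den ∈ PS (PolyVarγ n k₀) Ω Ωh ∧
      ∀ d : CRD n Ω Ωh T L Th Lh, ∀ x ∈ Ω,
        (Hd (d.f x) ≠ 0 → evalγ L d.γ d.f den x ≠ 0) ∧
        w d x * evalγ L d.γ d.f den x = evalγξ L d.γ d.ξ d.f num x := by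
  obtain ⟨N, P, hP, eP⟩ := h
  refine ⟨P, MvPolynomial.C (fun p => Hd p.2) * detP n k₀ ^ N, hP,
    Subring.mul_mem _ (PS_C (coef_hat hHd)) (Subring.pow_mem _ (detP_mem k₀) _), ?_⟩
  intro d x hx
  have e : evalγ L d.γ d.f (MvPolynomial.C (fun p => Hd p.2) * detP n k₀ ^ N) x =
      Hd (d.f x) * dg d x ^ N := by
    rw [← eval_detP k₀ d x]
    simp [evalγ, MvPolynomial.eval₂_mul, MvPolynomial.eval₂_pow]
  rw [e]
  refine ⟨fun h0 => mul_ne_zero h0 (pow_ne_zero _ (dg_ne d hx)), ?_⟩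
  rw [← eP d x hx]
  ring

end Fin

/-- Theorem 2.4.  Assume the hatted frame is `k₀`-nondegenerate and adapted
at `0` (hypotheses `hr0, hrn, hrmono, hadapta, hadaptb`).  Then for all `D, E` there are
reflection identities `γ^D_E = r^D_E(conj(L^J γ), conj(L^I ξ); f)` and
`η^D = s^D(conj(L^J γ), conj(L^I ξ); f)`, where `r^D_E` and `s^D` are rational in the
`conj(L^J γ^C_A)` (`|J| ≤ k₀−1`) and polynomial in the `conj(L^I ξ)` (`|I| ≤ k₀`), with
coefficients smooth on `Ω × Ω̂` depending only on the two frames and not on `f`; the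
identities hold near `0` with nonvanishing denominators, for every CR diffeomorphism `f`
with data `(γ, η, ξ)`. -/
theorem statement4 (n : ℕ) (hn : 1 ≤ n)
    (Ω Ωh : Set (Fin (2 * n + 1) → ℝ))
    (T : VF (2 * n + 1)) (L : Fin n → VF (2 * n + 1))
    (lv : Fin n → Fin n → (Fin (2 * n + 1) → ℝ) → ℂ)
    (hb : Fin n → (Fin (2 * n + 1) → ℝ) → ℂ)
    (Th : VF (2 * n + 1)) (Lh : Fin n → VF (2 * n + 1))
    (lvh : Fin n → Fin n → (Fin (2 * n + 1) → ℝ) → ℂ)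
    (hbh : Fin n → (Fin (2 * n + 1) → ℝ) → ℂ)
    (hF : NFrame n Ω T L lv hb) (hFh : NFrame n Ωh Th Lh lvh hbh)
    (k₀ : ℕ) (hk₀ : 1 ≤ k₀)
    (rr : ℕ → ℕ) (hr0 : rr 0 = 0) (hrn : rr k₀ = n)
    (hrmono : ∀ j < k₀, rr j ≤ rr (j + 1))
    (hadapta : ∀ j, 1 ≤ j → j ≤ k₀ → ∀ As : List (Fin n), As.length = j →
      ∀ a : Fin n, rr j ≤ (a : ℕ) → hIt Lh lvh hbh As a 0 = 0)
    (hadaptb : ∀ k, 1 ≤ k → k ≤ k₀ → ∀ v : Fin n → ℂ,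
      (∀ a : Fin n, (a : ℕ) < rr (k - 1) → v a = 0) →
      (∀ As : Fin k → Fin n,
        (∑ a ∈ Finset.univ.filter fun a : Fin n => rr (k - 1) ≤ (a : ℕ),
          v a * hIt Lh lvh hbh (List.ofFn As) a 0) = 0) →
      ∀ a : Fin n, (a : ℕ) < rr k → v a = 0) :
    ∀ D E : Fin n,
      ∃ (rNum : MvPolynomial (PolyVar n k₀) (CoefR n))
        (rDen : MvPolynomial (PolyVarγ n k₀) (CoefR n))
        (sNum : MvPolynomial (PolyVar n k₀) (CoefR n))
        (sDen : MvPolynomial (PolyVarγ n k₀) (CoefR n)),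
        (∀ d, ContDiffOn ℝ (⊤ : ℕ∞) (MvPolynomial.coeff d rNum) (Ω ×ˢ Ωh)) ∧
        (∀ d, ContDiffOn ℝ (⊤ : ℕ∞) (MvPolynomial.coeff d rDen) (Ω ×ˢ Ωh)) ∧
        (∀ d, ContDiffOn ℝ (⊤ : ℕ∞) (MvPolynomial.coeff d sNum) (Ω ×ˢ Ωh)) ∧
        (∀ d, ContDiffOn ℝ (⊤ : ℕ∞) (MvPolynomial.coeff d sDen) (Ω ×ˢ Ωh)) ∧
        ∀ (f : (Fin (2 * n + 1) → ℝ) → (Fin (2 * n + 1) → ℝ))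
          (γ : Fin n → Fin n → (Fin (2 * n + 1) → ℝ) → ℂ)
          (η : Fin n → (Fin (2 * n + 1) → ℝ) → ℂ)
          (ξ : (Fin (2 * n + 1) → ℝ) → ℝ),
          CRTrans n Ω Ωh T L Th Lh f γ η ξ →
          ∃ V : Set (Fin (2 * n + 1) → ℝ), IsOpen V ∧ (0 : Fin (2 * n + 1) → ℝ) ∈ V ∧
            V ⊆ Ω ∧
            ∀ x ∈ V,
              evalγ L γ f rDen x ≠ 0 ∧ evalγ L γ f sDen x ≠ 0 ∧
              γ D E x * evalγ L γ f rDen x = evalγξ L γ ξ f rNum x ∧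
              η D x * evalγ L γ f sDen x = evalγξ L γ ξ f sNum x := by
  have hnd : ∀ v : Fin n → ℂ,
      (∀ w ∈ {w : Fin n → ℂ | ∃ l : List (Fin n), l.length ≤ k₀ ∧
        w = fun a => hDrev Lh lvh hbh l a 0}, ∑ a, v a * w a = 0) → v = 0 := by
    intro v hv
    have key : ∀ k, k ≤ k₀ → ∀ a : Fin n, (a : ℕ) < rr k → v a = 0 := by
      intro k
      induction k with
      | zero => intro _ a ha; omega
      | succ k ih =>
        intro hk
        have ih' := ih (by omega)
        refine hadaptb (k + 1) (by omega) hk v (by simpa using ih') ?_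
        intro As
        have h1 := hv _ ⟨(List.ofFn As).reverse, by simpa using hk, rfl⟩
        rw [← h1]
        refine Finset.sum_subset (Finset.filter_subset _ _) ?_
        intro a _ ha
        have : (a : ℕ) < rr k := by simpa using ha
        rw [ih' a this, zero_mul]
    ext a
    exact key k₀ le_rfl a (by rw [hrn]; exact a.2)
  obtain ⟨g, hg, hdet⟩ := exists_det_ne _ hnd
  choose l hl hgl using hg
  set H : (Fin (2 * n + 1) → ℝ) → Matrix (Fin n) (Fin n) ℂ := fun y =>
    Matrix.of fun i C => hDrev Lh lvh hbh (l i) C y with hH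
  have hHs : ∀ i j, ContDiffOn ℝ (⊤ : ℕ∞) (fun y => H y i j) Ωh := fun i j =>
    hDrev_smooth hFh (l i) j
  have hHd : ContDiffOn ℝ (⊤ : ℕ∞) (fun y => (H y).det) Ωh := sm_det hHs
  have hH0 : (H 0).det ≠ 0 := by
    have : H 0 = Matrix.of g := by
      ext i j
      simp [hH, hgl]
    rwa [this]
  have FG : ∀ i, (∀ B, PRep k₀
      (fun (d : CRD n Ω Ωh T L Th Lh) => FF Lh lvh hbh d.f d.γ (l i) B)) ∧
      PRep k₀ (fun (d : CRD n Ω Ωh T L Th Lh) => GG Lh lvh hbh d.f d.η d.ξ (l i)) := fun i =>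
    ⟨fun B => ((RF.FG hF hFh (l i)).1 B).rep (hl i), (RF.FG hF hFh (l i)).2.rep (hl i)⟩
  intro D E
  have radj : ∀ i, PRep k₀ (fun (d : CRD n Ω Ωh T L Th Lh) x => (H (d.f x)).adjugate D i) :=
    fun i => PRep.coef (c := fun p => (H p.2).adjugate D i) (coef_hat (sm_adj hHs D i))
  have r1 : PRep k₀ (fun (d : CRD n Ω Ωh T L Th Lh) x => d.γ D E x * (H (d.f x)).det) := by
    refine (PRep.sum Finset.univ _ fun i => (radj i).mul ((FG i).1 E)).congr fun d x _ => ?_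
    exact adj_solve (H (d.f x)) (fun C => d.γ C E x) D
  have r2 : PRep k₀ (fun (d : CRD n Ω Ωh T L Th Lh) x => d.η D x * (H (d.f x)).det) := by
    have rξ : PRep k₀ (fun (d : CRD n Ω Ωh T L Th Lh) x => ((d.ξ x : ℝ) : ℂ)) :=
      (RF.rep (b := True) (k := 0) (by omega) (RF.vξ 0 [] (by simp))).congr fun d x _ => by
        simp [appOp]
    have rm : ∀ i, PRep k₀ (fun (d : CRD n Ω Ωh T L Th Lh) x =>
        -(hTrev Lh hbh (l i) (d.f x))) := fun i =>
      PRep.coef (c := fun p => -(hTrev Lh hbh (l i) p.2)) (coef_hat (hTrev_smooth hFh (l i))).neg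
    refine (PRep.sum Finset.univ _ fun i => (radj i).mul
      ((FG i).2.add (rξ.mul (rm i)))).congr fun d x _ => ?_
    rw [← adj_solve (H (d.f x)) (fun C => d.η C x) D]
    refine Finset.sum_congr rfl fun i _ => ?_
    simp only [GG, hH, Matrix.of_apply]
    ring
  obtain ⟨rNum, rDen, hrN, hrD, hr⟩ := assemble _ hHd _ r1
  obtain ⟨sNum, sDen, hsN, hsD, hs⟩ := assemble _ hHd _ r2
  refine ⟨rNum, rDen, sNum, sDen, hrN, hrD, hsN, hsD, ?_⟩
  intro f γ η ξ hc
  have hcont : ContinuousOn (fun x => (H (f x)).det) Ω :=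
    hHd.continuousOn.comp hc.smooth_f.continuousOn hc.maps
  refine ⟨Ω ∩ (fun x => (H (f x)).det) ⁻¹' {0}ᶜ,
    hcont.isOpen_inter_preimage hF.open_Ω isOpen_compl_singleton, ⟨hF.mem0, ?_⟩,
    Set.inter_subset_left, ?_⟩
  · simpa [hc.f0] using hH0
  · rintro x ⟨hx, hx2⟩
    have a1 := hr ⟨f, γ, η, ξ, hc⟩ x hx
    have a2 := hs ⟨f, γ, η, ξ, hc⟩ x hx
    exact ⟨a1.1 hx2, a2.1 hx2, a1.2, a2.2⟩
end
end

section
/- For every integer k ≥ 0 and all indices A₁, …, A_k, C, D ∈ {1,…,n}, the identity h_{Ā₁…Ā_k C̄ D} = L_C̄ h_{Ā₁…Ā_k D} + Σ_{B=1}^n h_{Ā₁…Ā_k B}·R^B_{C̄D} + h_{Ā₁…Ā_k}·h_{C̄D} holds on Ω, where for k = 0 one uses the conventions h_B := ⟨θ, L_B⟩ (which is 0) and the empty-index h := ⟨θ, T⟩ (which is 1). -/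
open scoped Topology

noncomputable section

/-- A complex 1-form on `ℝ^m`, given by its components in the standard coordinates. -/
abbrev Form (m : ℕ) := (Fin m → ℝ) → Fin m → ℂ

/-- The pairing `⟨ω,X⟩(x) = ω(x)(X(x))` of a 1-form with a vector field. -/
noncomputable def fpair {m : ℕ} (ω : Form m) (X : VF m) : (Fin m → ℝ) → ℂ :=
  fun x => ∑ i, ω x i * X x i

/-- `⟨dω, X∧Y⟩ = X⟨ω,Y⟩ − Y⟨ω,X⟩ − ⟨ω,[X,Y]⟩`. -/
noncomputable def dpair {m : ℕ} (ω : Form m) (X Y : VF m) (x : Fin m → ℝ) : ℂ :=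
  vapp X (fpair ω Y) x - vapp Y (fpair ω X) x - fpair ω (vbrk X Y) x

/-- The Lie derivative `ℒ_X ω := X ⌟ dω`, in components: its pairing with a constant
coordinate vector field is `⟨dω, X ∧ e_i⟩`. -/
noncomputable def lieD {m : ℕ} (X : VF m) (ω : Form m) : Form m :=
  fun x i => dpair ω X (fun _ => Pi.single i 1) x

/-- Iterated Lie derivative `ℒ_{X_k} ⋯ ℒ_{X_1} ω`, for `Xs = [X₁,…,X_k]`. -/
noncomputable def iterLieD {m : ℕ} (Xs : List (VF m)) (ω : Form m) : Form m :=
  Xs.foldl (fun w X => lieD X w) ω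

/-- `h_{Ā₁…Ā_k B} := ⟨ℒ_{L_{Ā_k}} ⋯ ℒ_{L_{Ā₁}} θ, L_B⟩` (for `As = [A₁,…,A_k]`). -/
noncomputable def hD {n : ℕ} (L : Fin n → VF (2 * n + 1)) (θ : Form (2 * n + 1))
    (As : List (Fin n)) (B : Fin n) : (Fin (2 * n + 1) → ℝ) → ℂ :=
  fpair (iterLieD (As.map fun A => vconj (L A)) θ) (L B)

/-- `h_{Ā₁…Ā_k} := ⟨ℒ_{L_{Ā_k}} ⋯ ℒ_{L_{Ā₁}} θ, T⟩`. -/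
noncomputable def hT {n : ℕ} (L : Fin n → VF (2 * n + 1)) (T : VF (2 * n + 1))
    (θ : Form (2 * n + 1)) (As : List (Fin n)) : (Fin (2 * n + 1) → ℝ) → ℂ :=
  fpair (iterLieD (As.map fun A => vconj (L A)) θ) T

/-- The frame and dual coframe data of Context 5/6/7/18: `T, L_A, L_Ā` is a smooth pointwise
basis of `ℂ^{2n+1}` on `Ω`, the span of the `L_Ā` is closed under brackets (integrable CR
structure of hypersurface type), and `θ, θ^A, θ^Ā` is the dual coframe. -/
structure CRFrame (n : ℕ) (Ω : Set (Fin (2 * n + 1) → ℝ)) (T : VF (2 * n + 1))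
    (L : Fin n → VF (2 * n + 1)) (θ : Form (2 * n + 1))
    (θup θbar : Fin n → Form (2 * n + 1)) : Prop where
  open_Ω : IsOpen Ω
  mem0 : (0 : Fin (2 * n + 1) → ℝ) ∈ Ω
  smoothT : ContDiffOn ℝ (⊤ : ℕ∞) T Ω
  smoothL : ∀ A, ContDiffOn ℝ (⊤ : ℕ∞) (L A) Ω
  smoothθ : ContDiffOn ℝ (⊤ : ℕ∞) θ Ω
  smoothθup : ∀ A, ContDiffOn ℝ (⊤ : ℕ∞) (θup A) Ω
  smoothθbar : ∀ A, ContDiffOn ℝ (⊤ : ℕ∞) (θbar A) Ω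
  indep : ∀ x ∈ Ω, LinearIndependent ℂ
    (Sum.elim (fun _ : Fin 1 => T x) (Sum.elim (fun A => L A x) (fun A => vconj (L A) x)))
  spans : ∀ x ∈ Ω, Submodule.span ℂ
    (Set.range (Sum.elim (fun _ : Fin 1 => T x)
      (Sum.elim (fun A => L A x) (fun A => vconj (L A) x)))) = ⊤
  integrable : ∀ A B, ∀ x ∈ Ω, vbrk (vconj (L A)) (vconj (L B)) x ∈
    Submodule.span ℂ (Set.range fun C => vconj (L C) x)
  dual_θ_T : ∀ x ∈ Ω, fpair θ T x = 1
  dual_θ_L : ∀ A, ∀ x ∈ Ω, fpair θ (L A) x = 0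
  dual_θ_Lb : ∀ A, ∀ x ∈ Ω, fpair θ (vconj (L A)) x = 0
  dual_θup_T : ∀ A, ∀ x ∈ Ω, fpair (θup A) T x = 0
  dual_θup_L : ∀ A B, ∀ x ∈ Ω, fpair (θup A) (L B) x = if A = B then 1 else 0
  dual_θup_Lb : ∀ A B, ∀ x ∈ Ω, fpair (θup A) (vconj (L B)) x = 0
  dual_θbar_T : ∀ A, ∀ x ∈ Ω, fpair (θbar A) T x = 0
  dual_θbar_L : ∀ A B, ∀ x ∈ Ω, fpair (θbar A) (L B) x = 0
  dual_θbar_Lb : ∀ A B, ∀ x ∈ Ω, fpair (θbar A) (vconj (L B)) x = if A = B then 1 else 0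

theorem vapp_fpair {m : ℕ} {ω : Form m} {X Y : VF m} {x : Fin m → ℝ}
    (hω : DifferentiableAt ℝ ω x) (hY : DifferentiableAt ℝ Y x) :
    vapp X (fpair ω Y) x = (∑ i, ∑ j, X x i * Y x j * fderiv ℝ (fun y => ω y j) x (Pi.single i 1))
      + fpair ω (fun x j => vapp X (fun y => Y y j) x) x := by
  have h1 : ∀ j, DifferentiableAt ℝ (fun y => ω y j) x := differentiableAt_pi.1 hω
  have h2 : ∀ j, DifferentiableAt ℝ (fun y => Y y j) x := differentiableAt_pi.1 hY
  have h3 : fderiv ℝ (fpair ω Y) x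
      = ∑ j, (ω x j • fderiv ℝ (fun y => Y y j) x + Y x j • fderiv ℝ (fun y => ω y j) x) := by
    unfold fpair
    rw [fderiv_fun_sum (fun j _ => (h1 j).fun_mul (h2 j))]
    exact Finset.sum_congr rfl fun j _ => fderiv_fun_mul (h1 j) (h2 j)
  unfold vapp
  rw [h3]
  simp only [fpair, _root_.sum_apply, _root_.add_apply,
    _root_.smul_apply, smul_eq_mul, Finset.mul_sum]
  rw [Finset.sum_comm (f := fun i j => ω x i * (X x j * _)), ← Finset.sum_add_distrib]
  refine Finset.sum_congr rfl fun i _ => ?_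
  rw [← Finset.sum_add_distrib]
  exact Finset.sum_congr rfl fun j _ => by ring

theorem dpair_eq {m : ℕ} {ω : Form m} {X Y : VF m} {x : Fin m → ℝ}
    (hω : DifferentiableAt ℝ ω x) (hX : DifferentiableAt ℝ X x) (hY : DifferentiableAt ℝ Y x) :
    dpair ω X Y x = ∑ j, (∑ i, X x i * (fderiv ℝ (fun y => ω y j) x (Pi.single i 1)
      - fderiv ℝ (fun y => ω y i) x (Pi.single j 1))) * Y x j := by
  have h : fpair ω (vbrk X Y) x = fpair ω (fun x j => vapp X (fun y => Y y j) x) x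
      - fpair ω (fun x j => vapp Y (fun y => X y j) x) x := by
    simp only [fpair, vbrk, mul_sub, Finset.sum_sub_distrib]
  unfold dpair
  rw [h, vapp_fpair hω hY, vapp_fpair hω hX]
  simp only [Finset.sum_mul, mul_sub, sub_mul, Finset.sum_sub_distrib]
  rw [Finset.sum_comm]
  have e1 : ∀ a b c d : ℂ, a + b - (c + d) - (b - d) = a - c := by intros; ring
  rw [e1]
  congr 1 <;> refine Finset.sum_congr rfl fun i _ => Finset.sum_congr rfl fun j _ => by ring

theorem lieD_eq {m : ℕ} {ω : Form m} {X : VF m} {x : Fin m → ℝ}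
    (hω : DifferentiableAt ℝ ω x) (hX : DifferentiableAt ℝ X x) (j : Fin m) :
    lieD X ω x j = ∑ i, X x i * (fderiv ℝ (fun y => ω y j) x (Pi.single i 1)
      - fderiv ℝ (fun y => ω y i) x (Pi.single j 1)) := by
  unfold lieD
  rw [dpair_eq hω hX (differentiableAt_const _)]
  simp [Pi.single_apply]

theorem fpair_lieD {m : ℕ} {ω : Form m} {X Y : VF m} {x : Fin m → ℝ}
    (hω : DifferentiableAt ℝ ω x) (hX : DifferentiableAt ℝ X x) (hY : DifferentiableAt ℝ Y x) :
    fpair (lieD X ω) Y x = dpair ω X Y x := by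
  rw [dpair_eq hω hX hY]
  simp only [fpair, lieD_eq hω hX]

theorem lieD_smooth {m : ℕ} {Ω : Set (Fin m → ℝ)} (hΩ : IsOpen Ω) {ω : Form m} {X : VF m}
    (hω : ContDiffOn ℝ (⊤ : ℕ∞) ω Ω) (hX : ContDiffOn ℝ (⊤ : ℕ∞) X Ω) :
    ContDiffOn ℝ (⊤ : ℕ∞) (lieD X ω) Ω := by
  have hd : ∀ {F : VF m}, ContDiffOn ℝ (⊤ : ℕ∞) F Ω → ∀ x ∈ Ω, DifferentiableAt ℝ F x :=
    fun h x hx => (h.contDiffAt (hΩ.mem_nhds hx)).differentiableAt (by simp)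
  have hf : ∀ i j, ContDiffOn ℝ (⊤ : ℕ∞)
      (fun x => fderiv ℝ (fun y => ω y j) x (Pi.single i 1)) Ω := fun i j =>
    ((contDiffOn_pi.1 hω j).fderiv_of_isOpen hΩ (by simp)).clm_apply contDiffOn_const
  refine contDiffOn_pi.2 fun j => ?_
  refine ContDiffOn.congr (f := fun x => ∑ i, X x i * (fderiv ℝ (fun y => ω y j) x (Pi.single i 1)
      - fderiv ℝ (fun y => ω y i) x (Pi.single j 1))) ?_
    fun x hx => lieD_eq (hd hω x hx) (hd hX x hx) j
  exact ContDiffOn.sum fun i _ => (contDiffOn_pi.1 hX i).mul ((hf i j).sub (hf j i))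

theorem vapp_const_on {m : ℕ} {Ω : Set (Fin m → ℝ)} (hΩ : IsOpen Ω) (X : VF m)
    {u : (Fin m → ℝ) → ℂ} (c : ℂ) (hu : ∀ x ∈ Ω, u x = c) {x : Fin m → ℝ} (hx : x ∈ Ω) :
    vapp X u x = 0 := by
  have : u =ᶠ[𝓝 x] fun _ => c := by
    filter_upwards [hΩ.mem_nhds hx] with y hy using hu y hy
  simp [vapp, this.fderiv_eq]

theorem fpair_span {m n : ℕ} {ω : Form m} {V : Fin n → VF m} {W : VF m} {x : Fin m → ℝ}
    (h : W x ∈ Submodule.span ℂ (Set.range fun C => V C x)) (h0 : ∀ C, fpair ω (V C) x = 0) :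
    fpair ω W x = 0 := by
  obtain ⟨c, hc⟩ := (Submodule.mem_span_range_iff_exists_fun ℂ).1 h
  have h0' : ∀ C, ω x ⬝ᵥ V C x = 0 := h0
  change ω x ⬝ᵥ W x = 0
  rw [← hc, dotProduct_sum]
  exact Finset.sum_eq_zero fun i _ => by rw [dotProduct_smul, h0' i, smul_zero]

theorem CRFrame.smoothLb {n : ℕ} {Ω : Set (Fin (2 * n + 1) → ℝ)}
    {T : VF (2 * n + 1)} {L : Fin n → VF (2 * n + 1)} {θ : Form (2 * n + 1)}
    {θup θbar : Fin n → Form (2 * n + 1)}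
    (hfr : CRFrame n Ω T L θ θup θbar) (A : Fin n) :
    ContDiffOn ℝ (⊤ : ℕ∞) (vconj (L A)) Ω :=
  contDiffOn_pi.2 fun i =>
    Complex.conjCLE.contDiff.comp_contDiffOn (contDiffOn_pi.1 (hfr.smoothL A) i)

theorem CRFrame.diff {n : ℕ} {Ω : Set (Fin (2 * n + 1) → ℝ)}
    {T : VF (2 * n + 1)} {L : Fin n → VF (2 * n + 1)} {θ : Form (2 * n + 1)}
    {θup θbar : Fin n → Form (2 * n + 1)}
    (hfr : CRFrame n Ω T L θ θup θbar) {F : VF (2 * n + 1)} (h : ContDiffOn ℝ (⊤ : ℕ∞) F Ω)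
    {x : Fin (2 * n + 1) → ℝ} (hx : x ∈ Ω) : DifferentiableAt ℝ F x :=
  (h.contDiffAt (hfr.open_Ω.mem_nhds hx)).differentiableAt (by simp)

theorem CRFrame.iter {n : ℕ} {Ω : Set (Fin (2 * n + 1) → ℝ)}
    {T : VF (2 * n + 1)} {L : Fin n → VF (2 * n + 1)} {θ : Form (2 * n + 1)}
    {θup θbar : Fin n → Form (2 * n + 1)}
    (hfr : CRFrame n Ω T L θ θup θbar) (As : List (Fin n)) :
    ∀ ω : Form (2 * n + 1), ContDiffOn ℝ (⊤ : ℕ∞) ω Ω →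
      (∀ A, ∀ x ∈ Ω, fpair ω (vconj (L A)) x = 0) →
      ContDiffOn ℝ (⊤ : ℕ∞) (iterLieD (As.map fun A => vconj (L A)) ω) Ω ∧
      ∀ A, ∀ x ∈ Ω, fpair (iterLieD (As.map fun A => vconj (L A)) ω) (vconj (L A)) x = 0 := by
  induction As with
  | nil => exact fun ω h h' => ⟨h, h'⟩
  | cons C As ih =>
    intro ω h h'
    refine ih (lieD (vconj (L C)) ω) (lieD_smooth hfr.open_Ω h (hfr.smoothLb C)) ?_
    intro A x hx
    rw [fpair_lieD (hfr.diff h hx) (hfr.diff (hfr.smoothLb C) hx) (hfr.diff (hfr.smoothLb A) hx)]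
    unfold dpair
    rw [vapp_const_on hfr.open_Ω _ 0 (h' A) hx, vapp_const_on hfr.open_Ω _ 0 (h' C) hx,
      fpair_span (hfr.integrable C A x hx) fun B => h' B x hx]
    simp

theorem CRFrame.expand {n : ℕ} {Ω : Set (Fin (2 * n + 1) → ℝ)}
    {T : VF (2 * n + 1)} {L : Fin n → VF (2 * n + 1)} {θ : Form (2 * n + 1)}
    {θup θbar : Fin n → Form (2 * n + 1)}
    (hfr : CRFrame n Ω T L θ θup θbar) (ω : Form (2 * n + 1)) (W : VF (2 * n + 1))
    {x : Fin (2 * n + 1) → ℝ} (hx : x ∈ Ω) (h0 : ∀ A, fpair ω (vconj (L A)) x = 0) :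
    fpair ω W x = fpair θ W x * fpair ω T x + ∑ B, fpair (θup B) W x * fpair ω (L B) x := by
  have hW : W x ∈ Submodule.span ℂ (Set.range (Sum.elim (fun _ : Fin 1 => T x)
      (Sum.elim (fun A => L A x) (fun A => vconj (L A) x)))) := by
    rw [hfr.spans x hx]; trivial
  obtain ⟨c, hc⟩ := (Submodule.mem_span_range_iff_exists_fun ℂ).1 hW
  have key : ∀ η : Form (2 * n + 1), fpair η W x = c (Sum.inl 0) * fpair η T x
      + (∑ B, c (Sum.inr (Sum.inl B)) * fpair η (L B) x
      + ∑ B, c (Sum.inr (Sum.inr B)) * fpair η (vconj (L B)) x) := by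
    intro η
    change η x ⬝ᵥ W x = _
    rw [← hc, dotProduct_sum]
    simp only [dotProduct_smul, Fintype.sum_sum_type, Sum.elim_inl, Sum.elim_inr,
      Fin.sum_univ_one, smul_eq_mul, Fin.isValue]
    rfl
  have k1 : fpair θ W x = c (Sum.inl 0) := by
    rw [key]
    simp [hfr.dual_θ_T x hx, hfr.dual_θ_L _ x hx, hfr.dual_θ_Lb _ x hx]
  have k2 : ∀ B, fpair (θup B) W x = c (Sum.inr (Sum.inl B)) := by
    intro B
    rw [key]
    simp [hfr.dual_θup_T _ x hx, hfr.dual_θup_L _ _ x hx, hfr.dual_θup_Lb _ _ x hx]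
  simp only [k1, k2]
  rw [key]
  simp [h0]

/-- For every `k ≥ 0` and indices `A₁,…,A_k, C, D`, the identity
`h_{Ā₁…Ā_k C̄ D} = L_C̄ h_{Ā₁…Ā_k D} + Σ_B h_{Ā₁…Ā_k B}·R^B_{C̄D} + h_{Ā₁…Ā_k}·h_{C̄D}`
holds on `Ω`, where `R^B_{C̄D} = ⟨dθ^B, L_C̄ ∧ L_D⟩`; for `k = 0` the conventions
`h_B = ⟨θ, L_B⟩` and `h = ⟨θ, T⟩` are built into the definitions `hD`/`hT` (empty list). -/
theorem statement5 (n : ℕ) (hn : 1 ≤ n) (Ω : Set (Fin (2 * n + 1) → ℝ))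
    (T : VF (2 * n + 1)) (L : Fin n → VF (2 * n + 1)) (θ : Form (2 * n + 1))
    (θup θbar : Fin n → Form (2 * n + 1))
    (hfr : CRFrame n Ω T L θ θup θbar) :
    ∀ (As : List (Fin n)) (C D : Fin n), ∀ x ∈ Ω,
      hD L θ (As ++ [C]) D x =
        vapp (vconj (L C)) (hD L θ As D) x
          + (∑ B, hD L θ As B x * dpair (θup B) (vconj (L C)) (L D) x)
          + hT L T θ As x * hD L θ [C] D x := by
  intro As C D x hx
  obtain ⟨hs, h0⟩ := hfr.iter As θ hfr.smoothθ hfr.dual_θ_Lb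
  have dC := hfr.diff (hfr.smoothLb C) hx
  have dD := hfr.diff (hfr.smoothL D) hx
  have e1 : hD L θ (As ++ [C]) D x
      = dpair (iterLieD (As.map fun A => vconj (L A)) θ) (vconj (L C)) (L D) x := by
    rw [← fpair_lieD (hfr.diff hs hx) dC dD]
    simp [hD, iterLieD]
  have e2 : hD L θ [C] D x = - fpair θ (vbrk (vconj (L C)) (L D)) x := by
    have : hD L θ [C] D x = dpair θ (vconj (L C)) (L D) x :=
      fpair_lieD (hfr.diff hfr.smoothθ hx) dC dD
    rw [this]
    unfold dpair
    rw [vapp_const_on hfr.open_Ω _ 0 (hfr.dual_θ_L D) hx,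
      vapp_const_on hfr.open_Ω _ 0 (hfr.dual_θ_Lb C) hx]
    simp
  have e3 : ∀ B, dpair (θup B) (vconj (L C)) (L D) x
      = - fpair (θup B) (vbrk (vconj (L C)) (L D)) x := by
    intro B
    unfold dpair
    rw [vapp_const_on hfr.open_Ω _ _ (hfr.dual_θup_L B D) hx,
      vapp_const_on hfr.open_Ω _ 0 (hfr.dual_θup_Lb B C) hx]
    simp
  rw [e1, e2]
  simp only [e3]
  unfold dpair
  rw [vapp_const_on hfr.open_Ω _ 0 (h0 C) hx, hfr.expand _ _ hx fun A => h0 A x hx]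
  unfold hD hT
  simp only [mul_neg, Finset.sum_neg_distrib]
  simp only [mul_comm]
  ring
end
end
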